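/- arXiv:2602.10769 — 2 statements merged into one kernel-verified Lean document; each statement's English description precedes it below -/
import Mathlib

section
/- Let g₁, g₂ ∈ SL₂(ℝ) with gᵢ = (aᵢ,bᵢ;cᵢ,dᵢ), write g₃ = g₁g₂ = (a₃,b₃;c₃,d₃), and let z lie in the upper half-plane ℍ. Then √(c₃z + d₃) = √(c₁·(g₂z) + d₁) · √(c₂z + d₂) · c̄(g₁,g₂), where g₂z = (a₂z+b₂)/(c₂z+d₂). -/
noncomputable section

/-- The real Hilbert symbol `(a,b)_ℝ`. -/
def hilb (a b : ℝ) : ℝ := if a < 0 ∧ b < 0 then -1 else 1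

def xEnt (g : Matrix (Fin 2) (Fin 2) ℝ) : ℝ := if g 1 0 = 0 then g 1 1 else g 1 0

/-- Rao's sign cocycle `c̄` on `SL₂(ℝ)`. -/
def raoC (g₁ g₂ : Matrix (Fin 2) (Fin 2) ℝ) : ℝ :=
  hilb (xEnt g₁) (xEnt g₂) * hilb (-(xEnt g₁ * xEnt g₂)) (xEnt (g₁ * g₂))

/-- The argument of a nonzero complex number, normalized to lie in `[-π, π)`. -/
def myArg (z : ℂ) : ℝ := if Complex.arg z = Real.pi then -Real.pi else Complex.arg z

/-- `√w := |w|^{1/2} · e^{i·Arg(w)/2}` with `Arg ∈ [-π, π)`. -/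
def sqrtBr (w : ℂ) : ℂ :=
  ((‖w‖ ^ ((1 : ℝ) / 2) : ℝ) : ℂ) * Complex.exp (Complex.I * (myArg w) / 2)

/-- The Möbius action of a `2 × 2` real matrix on `ℂ`. -/
def mobius (g : Matrix (Fin 2) (Fin 2) ℝ) (z : ℂ) : ℂ :=
  ((g 0 0 : ℂ) * z + (g 0 1 : ℂ)) / ((g 1 0 : ℂ) * z + (g 1 1 : ℂ))

theorem myArg_bounds (w : ℂ) : -Real.pi ≤ myArg w ∧ myArg w < Real.pi := by
  have h1 := Complex.neg_pi_lt_arg w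
  have h2 := Complex.arg_le_pi w
  have := Real.pi_pos
  unfold myArg
  split_ifs with h
  · constructor <;> linarith
  · exact ⟨h1.le, lt_of_le_of_ne h2 h⟩

theorem norm_mul_exp_myArg (w : ℂ) :
    (‖w‖ : ℂ) * Complex.exp (myArg w * Complex.I) = w := by
  conv_rhs => rw [← Complex.norm_mul_exp_arg_mul_I w]
  unfold myArg
  split_ifs with h
  · rw [h]
    push_cast
    rw [neg_mul, Complex.exp_neg, Complex.exp_pi_mul_I]
    norm_num
  · rfl

/-- `x` records the sign of the argument of `w`. -/
def SignOf (x : ℝ) (w : ℂ) : Prop :=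
  (0 < x ∧ 0 ≤ myArg w) ∨ (x < 0 ∧ myArg w < 0)

theorem signOf_row (g : Matrix (Fin 2) (Fin 2) ℝ) (hg : g.det = 1) (z : ℂ) (hz : 0 < z.im) :
    SignOf (xEnt g) ((g 1 0 : ℂ) * z + (g 1 1 : ℂ)) := by
  have hpi := Real.pi_pos
  rw [Matrix.det_fin_two] at hg
  unfold SignOf xEnt
  by_cases hc : g 1 0 = 0
  · have hd : g 1 1 ≠ 0 := by
      intro hd
      rw [hc, hd] at hg
      norm_num at hg
    simp only [hc, if_true, Complex.ofReal_zero, zero_mul, zero_add]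
    rcases lt_or_gt_of_ne hd with h | h
    · right
      refine ⟨h, ?_⟩
      unfold myArg
      rw [Complex.arg_ofReal_of_neg h]
      simpa using hpi
    · left
      refine ⟨h, ?_⟩
      unfold myArg
      rw [Complex.arg_ofReal_of_nonneg h.le, if_neg hpi.ne]
  · have him : ((g 1 0 : ℂ) * z + (g 1 1 : ℂ)).im = g 1 0 * z.im := by simp
    simp only [hc, if_false]
    rcases lt_or_gt_of_ne hc with h | h
    · right
      refine ⟨h, ?_⟩
      have : Complex.arg ((g 1 0 : ℂ) * z + (g 1 1 : ℂ)) < 0 := by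
        rw [Complex.arg_neg_iff, him]
        exact mul_neg_of_neg_of_pos h hz
      unfold myArg
      split_ifs <;> linarith
    · left
      refine ⟨h, ?_⟩
      have hp : 0 < ((g 1 0 : ℂ) * z + (g 1 1 : ℂ)).im := by
        rw [him]
        exact mul_pos h hz
      have h0 : 0 ≤ Complex.arg ((g 1 0 : ℂ) * z + (g 1 1 : ℂ)) :=
        Complex.arg_nonneg_iff.2 hp.le
      have h1 : Complex.arg ((g 1 0 : ℂ) * z + (g 1 1 : ℂ)) ≠ Real.pi := by
        rw [Ne, Complex.arg_eq_pi_iff]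
        exact fun h => hp.ne' h.2
      unfold myArg
      rwa [if_neg h1]

theorem row_ne_zero (g : Matrix (Fin 2) (Fin 2) ℝ) (hg : g.det = 1) (z : ℂ) (hz : 0 < z.im) :
    (g 1 0 : ℂ) * z + (g 1 1 : ℂ) ≠ 0 := by
  intro h
  rw [Matrix.det_fin_two] at hg
  have him := congrArg Complex.im h
  have hre := congrArg Complex.re h
  simp at him hre
  have hc : g 1 0 = 0 := by
    rcases him with h | h
    · exact h
    · exact absurd h hz.ne'
  rw [hc] at hre
  have hd : g 1 1 = 0 := by linarith
  rw [hc, hd] at hg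
  norm_num at hg

theorem mobius_im_pos (g : Matrix (Fin 2) (Fin 2) ℝ) (hg : g.det = 1) (z : ℂ) (hz : 0 < z.im) :
    0 < (mobius g z).im := by
  have hne := row_ne_zero g hg z hz
  rw [Matrix.det_fin_two] at hg
  have hn := Complex.normSq_pos.2 hne
  have : (mobius g z).im = z.im / Complex.normSq ((g 1 0 : ℂ) * z + (g 1 1 : ℂ)) := by
    unfold mobius
    rw [Complex.div_im, ← sub_div]
    congr 1
    simp
    linear_combination z.im * hg
  rw [this]
  exact div_pos hz hn

theorem sqrtBr_mul (u v : ℂ) (hu : u ≠ 0) (hv : v ≠ 0) (x y t : ℝ)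
    (hx : SignOf x u) (hy : SignOf y v) (ht : SignOf t (u * v)) :
    sqrtBr (u * v) = sqrtBr u * sqrtBr v * ((hilb x y * hilb (-(x * y)) t : ℝ) : ℂ) := by
  have hpi := Real.pi_pos
  obtain ⟨bu, bu'⟩ := myArg_bounds u
  obtain ⟨bv, bv'⟩ := myArg_bounds v
  obtain ⟨bw, bw'⟩ := myArg_bounds (u * v)
  have he : Complex.exp (myArg (u * v) * Complex.I)
      = Complex.exp ((myArg u + myArg v) * Complex.I) := by
    have hn : ((‖u‖ : ℂ) * ‖v‖) ≠ 0 := by simp [hu, hv]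
    apply mul_left_cancel₀ hn
    have h1 := norm_mul_exp_myArg (u * v)
    rw [norm_mul, Complex.ofReal_mul] at h1
    rw [h1, add_mul, Complex.exp_add]
    conv_lhs => rw [← norm_mul_exp_myArg u, ← norm_mul_exp_myArg v]
    ring
  obtain ⟨n, hn⟩ := Complex.exp_eq_exp_iff_exists_int.1 he
  have hn' : myArg (u * v) = myArg u + myArg v + n * (2 * Real.pi) := by
    have := congrArg Complex.im hn
    simpa using this
  have key : sqrtBr (u * v) = sqrtBr u * sqrtBr v * Complex.exp (n * (Real.pi * Complex.I)) := by
    unfold sqrtBr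
    rw [hn', norm_mul, Real.mul_rpow (norm_nonneg _) (norm_nonneg _)]
    have : Complex.I * ((myArg u + myArg v + n * (2 * Real.pi) : ℝ) : ℂ) / 2
        = Complex.I * myArg u / 2 + Complex.I * myArg v / 2 + n * (Real.pi * Complex.I) := by
      push_cast
      ring
    rw [this, Complex.exp_add, Complex.exp_add]
    push_cast
    ring
  rw [key]
  congr 1
  have hlt : (n : ℝ) < 2 := by
    by_contra hc
    nlinarith
  have hgt : (-2 : ℝ) < n := by
    by_contra hc
    nlinarith
  have hlt' : n < 2 := by exact_mod_cast hlt
  have hgt' : -2 < n := by exact_mod_cast hgt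
  have hxy1 : 0 < x → 0 < y → 0 < x * y := mul_pos
  have hxy2 : x < 0 → y < 0 → 0 < x * y := mul_pos_of_neg_of_neg
  have hxy3 : 0 < x → y < 0 → x * y < 0 := mul_neg_of_pos_of_neg
  have hxy4 : x < 0 → 0 < y → x * y < 0 := mul_neg_of_neg_of_pos
  have fin : hilb x y * hilb (-(x * y)) t = if n = 0 then 1 else -1 := by
    have hcases : n = -1 ∨ n = 0 ∨ n = 1 := by omega
    unfold hilb
    rcases hx with ⟨hx, ax⟩ | ⟨hx, ax⟩ <;> rcases hy with ⟨hy, ay⟩ | ⟨hy, ay⟩ <;>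
      rcases ht with ⟨ht, az⟩ | ⟨ht, az⟩ <;> rcases hcases with h | h | h <;>
      subst h <;> push_cast at hn' <;>
      first
        | (exfalso; linarith)
        | (have := hxy1 hx hy; simp [hx, hy, ht, this, hx.le, hy.le, ht.le, not_lt.2, this.le])
        | (have := hxy2 hx hy; simp [hx, hy, ht, this, hx.le, hy.le, ht.le, not_lt.2, this.le])
        | (have := hxy3 hx hy; simp [hx, hy, ht, this, hx.le, hy.le, ht.le, not_lt.2, this.le])
        | (have := hxy4 hx hy; simp [hx, hy, ht, this, hx.le, hy.le, ht.le, not_lt.2, this.le])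
  rw [fin]
  have hcases : n = -1 ∨ n = 0 ∨ n = 1 := by omega
  rcases hcases with h | h | h <;> subst h
  · simp [Complex.exp_neg, Complex.exp_pi_mul_I]
  · simp
  · simp [Complex.exp_pi_mul_I]

theorem statement4 (g₁ g₂ : Matrix (Fin 2) (Fin 2) ℝ) (h₁ : g₁.det = 1) (h₂ : g₂.det = 1)
    (z : ℂ) (hz : 0 < z.im) :
    sqrtBr (((g₁ * g₂) 1 0 : ℂ) * z + ((g₁ * g₂) 1 1 : ℂ)) =
      sqrtBr ((g₁ 1 0 : ℂ) * mobius g₂ z + (g₁ 1 1 : ℂ)) *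
        sqrtBr ((g₂ 1 0 : ℂ) * z + (g₂ 1 1 : ℂ)) * (raoC g₁ g₂ : ℂ) := by
  have hm := mobius_im_pos g₂ h₂ z hz
  have hv := row_ne_zero g₂ h₂ z hz
  have hu := row_ne_zero g₁ h₁ _ hm
  have hw : (((g₁ * g₂) 1 0 : ℝ) : ℂ) * z + (((g₁ * g₂) 1 1 : ℝ) : ℂ) =
      ((g₁ 1 0 : ℂ) * mobius g₂ z + (g₁ 1 1 : ℂ)) * ((g₂ 1 0 : ℂ) * z + (g₂ 1 1 : ℂ)) := by
    have e : mobius g₂ z * ((g₂ 1 0 : ℂ) * z + (g₂ 1 1 : ℂ))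
        = (g₂ 0 0 : ℂ) * z + (g₂ 0 1 : ℂ) := div_mul_cancel₀ _ hv
    simp only [Matrix.mul_apply, Fin.sum_univ_two]
    push_cast
    linear_combination -(g₁ 1 0 : ℂ) * e
  have h₃ : (g₁ * g₂).det = 1 := by rw [Matrix.det_mul, h₁, h₂, one_mul]
  have s₃ := signOf_row _ h₃ z hz
  rw [hw] at s₃ ⊢
  exact sqrtBr_mul _ _ hu hv _ _ _ (signOf_row g₁ h₁ _ hm) (signOf_row g₂ h₂ z hz) s₃
end
end

section
/- Let N ≥ 1 be an odd integer, t ≥ 1 an integer, χ a primitive Dirichlet character modulo N, 𝔴 = diag(t,1), and z ∈ ℍ. For χ even define θ^{F,1/2}_{χ,t}(z) := Σ_{n∈ℤ} χ(n+(N+1)/2)·e^{iπtz(n+1/2)²}, and for χ odd define θ^{F,3/2}_{χ,t}(z) := Σ_{n∈ℤ} χ(n+(N+1)/2)·(n+1/2)·e^{iπtz(n+1/2)²}. Let r = (a,b;c,d) ∈ SL₂(ℚ) be such that r' := 𝔴r𝔴⁻¹ lies in Γ₀(2) ∩ Γ₀(N²), and set u₋(−1) = (1,0;−1,1). Then u₋(−1)·r'·u₋(−1)⁻¹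 ∈ Γ_θ, and with the multiplier ν(r) := c̄(u₋(−1), r') · c̄(u₋(−1)·r', u₋(−1)⁻¹) · λ(u₋(−1)·r'·u₋(−1)⁻¹), one has, for κ = 1 when χ is even and κ = 3 when χ is odd: θ^{F,κ/2}_{χ,t}((az+b)/(cz+d)) = ν(r)·(√(cz+d))^κ·χ(d)·θ^{F,κ/2}_{χ,t}(z). -/
noncomputable section

/-- The function `m(g)` on `SL₂(ℝ)`. -/
def mX (g : Matrix (Fin 2) (Fin 2) ℝ) : ℂ :=
  if g 1 0 = 0 then
    Complex.exp (Complex.I * (Real.pi : ℂ) / 4 * ((1 : ℂ) - (Real.sign (g 1 1) : ℂ)))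
  else Complex.exp (-(Complex.I * (Real.pi : ℂ) / 4) * (Real.sign (g 1 0) : ℂ))

def toR (g : Matrix (Fin 2) (Fin 2) ℤ) : Matrix (Fin 2) (Fin 2) ℝ := g.map fun x => (x : ℝ)

/-- The symplectic Gauss sum `G(d, c)`. -/
def gaussG (d c : ℤ) : ℂ :=
  (((c.natAbs : ℝ) ^ (-(1 : ℝ) / 2) : ℝ) : ℂ) *
    ∑ n ∈ Finset.range c.natAbs,
      Complex.exp (-(Real.pi : ℂ) * Complex.I * (d : ℂ) * (n : ℂ) ^ 2 / (c : ℂ))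

/-- `β̃(g)` on `Γ_θ`. -/
def betaTilde (g : Matrix (Fin 2) (Fin 2) ℤ) : ℂ :=
  if g 1 0 = 0 then 1 else gaussG (g 1 1) (g 1 0)

/-- The theta multiplier `λ(g) := m(g) · β̃(g)⁻¹`. -/
def lamTheta (g : Matrix (Fin 2) (Fin 2) ℤ) : ℂ := mX (toR g) * (betaTilde g)⁻¹

/-- `θ^{F,1/2}_{χ,t}(z) := Σ_{n ∈ ℤ} χ(n + (N+1)/2) e^{iπtz(n+1/2)²}`. -/
def thetaFHalfT {N : ℕ} (χ : DirichletCharacter ℂ N) (t : ℕ) (z : ℂ) : ℂ :=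
  ∑' n : ℤ, χ ((n + ((N : ℤ) + 1) / 2 : ℤ) : ZMod N) *
    Complex.exp (Complex.I * (Real.pi : ℂ) * (t : ℂ) * z * ((n : ℂ) + 1 / 2) ^ 2)

/-- `θ^{F,3/2}_{χ,t}(z) := Σ_{n ∈ ℤ} χ(n + (N+1)/2) (n + 1/2) e^{iπtz(n+1/2)²}`. -/
def thetaFThreeHalfT {N : ℕ} (χ : DirichletCharacter ℂ N) (t : ℕ) (z : ℂ) : ℂ :=
  ∑' n : ℤ, χ ((n + ((N : ℤ) + 1) / 2 : ℤ) : ZMod N) * ((n : ℂ) + 1 / 2) *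
    Complex.exp (Complex.I * (Real.pi : ℂ) * (t : ℂ) * z * ((n : ℂ) + 1 / 2) ^ 2)


/-! ### Helper material -/

/-- `ex x = e^{π i x}`. -/
def ex (x : ℂ) : ℂ := Complex.exp (Real.pi * Complex.I * x)

lemma ex_add (x y : ℂ) : ex (x + y) = ex x * ex y := by
  unfold ex; rw [← Complex.exp_add]; ring_nf

lemma ex_zero : ex 0 = 1 := by simp [ex]

lemma ex_int_two (n : ℤ) : ex (2 * n) = 1 := by
  unfold ex
  rw [Complex.exp_eq_one_iff]
  exact ⟨n, by ring⟩

lemma ex_even {n : ℤ} (h : Even n) : ex n = 1 := by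
  obtain ⟨k, rfl⟩ := h
  rw [← ex_int_two k]; push_cast; ring_nf

lemma ex_odd {n : ℤ} (h : Odd n) : ex n = -1 := by
  obtain ⟨k, rfl⟩ := h
  push_cast
  rw [ex_add, ex_int_two]
  simp [ex]

lemma ex_eq_of_sub {x y : ℂ} (n : ℤ) (h : x = y + 2 * n) : ex x = ex y := by
  rw [h, ex_add, ex_int_two, mul_one]

lemma hs_congr {f g : ℤ → ℂ} {a b : ℂ} (h : HasSum f a) (hb : b = a) (hf : g = f) :
    HasSum g b := by rw [hf, hb]; exact h

/-- The Poisson summation for one residue class. -/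
lemma poisson_class (e P : ℕ) (he : e = 0 ∨ e = 1) (hP : 0 < P) (r : ℕ) (τ : ℂ) (hτ : 0 < τ.im) :
    ∃ v : ℂ, HasSum (fun j : ℤ => ((r : ℂ) + P * j) ^ e *
        ex (-((r : ℂ) + P * j) ^ 2 / ((P : ℂ) ^ 2 * τ))) ((-(P * τ)) ^ e * (-Complex.I * τ) ^ (1 / 2 : ℂ) * v) ∧
      HasSum (fun k : ℤ => (k : ℂ) ^ e * ex (2 * k * r / P) * ex (k ^ 2 * τ)) v := by
  have hτ0 : τ ≠ 0 := by rintro rfl; simp at hτ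
  have hP0 : (P : ℂ) ≠ 0 := by exact_mod_cast hP.ne'
  have hsq : (-Complex.I * τ) ^ (1 / 2 : ℂ) ≠ 0 := by
    rw [Ne, Complex.cpow_eq_zero_iff]; simp [hτ0]
  have him : 0 < (-1 / τ).im := by
    rw [neg_div, one_div, Complex.neg_im, Complex.inv_im, neg_div, neg_neg]
    exact div_pos hτ (Complex.normSq_pos.2 hτ0)
  have hpi : (2 * Real.pi * Complex.I : ℂ) ≠ 0 := Complex.two_pi_I_ne_zero
  set z : ℂ := -(r / P) with hz
  have hterm : ∀ j : ℤ, ex (-((r : ℂ) + P * j) ^ 2 / ((P : ℂ) ^ 2 * τ)) =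
      Complex.exp (-Real.pi * Complex.I * z ^ 2 / τ) * jacobiTheta₂_term j (z / τ) (-1 / τ) := by
    intro j
    unfold ex jacobiTheta₂_term
    rw [← Complex.exp_add, hz]
    congr 1
    field_simp
    ring
  have hterm2 : ∀ k : ℤ, ex (2 * k * r / P) * ex (k ^ 2 * τ) = jacobiTheta₂_term k (-z) τ := by
    intro k
    unfold jacobiTheta₂_term
    rw [← ex_add, hz]; unfold ex
    congr 1
    field_simp
    try ring
  have h1 := hasSum_jacobiTheta₂_term (z / τ) him
  have h2 := hasSum_jacobiTheta₂_term (-z) hτ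
  rcases he with rfl | rfl
  · refine ⟨jacobiTheta₂ (-z) τ, ?_, ?_⟩
    · have h3 := h1.mul_left (Complex.exp (-Real.pi * Complex.I * z ^ 2 / τ))
      simp only [hterm, pow_zero, one_mul]
      refine hs_congr h3 ?_ rfl
      rw [jacobiTheta₂_neg_left, jacobiTheta₂_functional_equation z τ]
      field_simp
    · simp only [pow_zero, one_mul, hterm2]; exact h2
  · have h1' := hasSum_jacobiTheta₂'_term (z / τ) him
    have h2' := hasSum_jacobiTheta₂'_term (-z) hτ
    refine ⟨(2 * Real.pi * Complex.I)⁻¹ * jacobiTheta₂' (-z) τ, ?_, ?_⟩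
    · have h3 := ((h1'.sub (h1.mul_left (2 * Real.pi * Complex.I * z))).mul_left
        (Complex.exp (-Real.pi * Complex.I * z ^ 2 / τ))).mul_left (P * (2 * Real.pi * Complex.I)⁻¹)
      refine (fun A B => hs_congr h3 B A) ?_ ?_
      · funext j
        rw [hterm, jacobiTheta₂'_term, hz]
        have := Complex.I_ne_zero
        have : (Real.pi : ℂ) ≠ 0 := by exact_mod_cast Real.pi_ne_zero
        field_simp
        ring
      · rw [jacobiTheta₂'_neg_left, jacobiTheta₂'_functional_equation z τ]
        have := Complex.I_ne_zero
        have : (Real.pi : ℂ) ≠ 0 := by exact_mod_cast Real.pi_ne_zero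
        field_simp
    · have h3 := h2'.mul_left (2 * Real.pi * Complex.I)⁻¹
      refine hs_congr h3 rfl ?_
      funext k
      rw [jacobiTheta₂'_term, mul_assoc, hterm2]
      have := Complex.I_ne_zero
      have : (Real.pi : ℂ) ≠ 0 := by exact_mod_cast Real.pi_ne_zero
      field_simp

lemma per_mul {P : ℕ} {F : ℤ → ℂ} (hF : ∀ n, F (n + P) = F n) (n j : ℤ) :
    F (n + P * j) = F n := by
  have h : Function.Periodic F (P : ℤ) := hF
  have := h.int_mul j n
  rw [← this]; congr 1; simp; ring

/-- Poisson summation for a periodic weight. -/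
lemma poisson (e P : ℕ) (he : e = 0 ∨ e = 1) (hP : 0 < P) (F : ℤ → ℂ) (hF : ∀ n, F (n + P) = F n)
    (τ : ℂ) (hτ : 0 < τ.im) :
    ∑' n : ℤ, F n * (n : ℂ) ^ e * ex (-(n : ℂ) ^ 2 / ((P : ℂ) ^ 2 * τ)) =
      (-(P * τ)) ^ e * (-Complex.I * τ) ^ (1 / 2 : ℂ) * ∑' k : ℤ,
        (∑ r ∈ Finset.range P, F r * ex (2 * k * r / P)) * (k : ℂ) ^ e * ex (k ^ 2 * τ) := by
  choose v hv1 hv2 using fun r => poisson_class e P he hP r τ hτ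
  have hL : HasSum (fun n : ℤ => F n * (n : ℂ) ^ e * ex (-(n : ℂ) ^ 2 / ((P : ℂ) ^ 2 * τ)))
      (∑ r ∈ Finset.range P, F r * ((-(P * τ)) ^ e * (-Complex.I * τ) ^ (1 / 2 : ℂ) * v r)) := by
    have h : ∀ r ∈ Finset.range P, HasSum (fun n : ℤ => if n % P = (r : ℤ) then
        F n * (n : ℂ) ^ e * ex (-(n : ℂ) ^ 2 / ((P : ℂ) ^ 2 * τ)) else 0)
        (F r * ((-(P * τ)) ^ e * (-Complex.I * τ) ^ (1 / 2 : ℂ) * v r)) := by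
      intro r hr
      have hinj : Function.Injective (fun j : ℤ => (r : ℤ) + P * j) := by
        intro x y hxy
        have : (P : ℤ) ≠ 0 := by exact_mod_cast hP.ne'
        exact mul_left_cancel₀ this (add_left_cancel hxy)
      rw [← hinj.hasSum_iff]
      · refine hs_congr ((hv1 r).mul_left (F r)) rfl ?_
        funext j
        have hmod : ((r : ℤ) + P * j) % P = (r : ℤ) := by
          rw [Int.add_mul_emod_self_left]
          exact Int.emod_eq_of_lt (by positivity) (by exact_mod_cast Finset.mem_range.1 hr)
        simp only [Function.comp, hmod, if_true, per_mul hF]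
        push_cast
        ring
      · intro n hn
        rw [if_neg]
        intro hmod
        apply hn
        exact ⟨n / P, by rw [← hmod]; exact Int.emod_add_mul_ediv n P⟩
    have h2 := hasSum_sum h
    refine hs_congr h2 rfl ?_
    funext n
    have hPz : (0 : ℤ) < P := by exact_mod_cast hP
    have hm0 := Int.emod_nonneg n hPz.ne'
    have hm1 := Int.emod_lt_of_pos n hPz
    rw [Finset.sum_eq_single (n % P).toNat]
    · rw [if_pos]; rw [Int.toNat_of_nonneg hm0]
    · intro b _ hb
      rw [if_neg]; intro h; apply hb; omega
    · intro h; exfalso; apply h; rw [Finset.mem_range]; omega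
  rw [hL.tsum_eq]
  have hR : HasSum (fun k : ℤ =>
        (∑ r ∈ Finset.range P, F r * ex (2 * k * r / P)) * (k : ℂ) ^ e * ex (k ^ 2 * τ))
        (∑ r ∈ Finset.range P, F r * v r) := by
    have h2 := hasSum_sum (s := Finset.range P) (fun r _ => (hv2 r).mul_left (F r))
    refine hs_congr h2 rfl ?_
    funext k
    rw [Finset.sum_mul, Finset.sum_mul]
    exact Finset.sum_congr rfl fun r _ => by ring
  rw [hR.tsum_eq, Finset.mul_sum]
  exact Finset.sum_congr rfl fun r _ => by ring

lemma sum_shift_one {P : ℕ} {F : ℤ → ℂ} (hF : ∀ n, F (n + P) = F n) :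
    ∑ r ∈ Finset.range P, F (r + 1) = ∑ r ∈ Finset.range P, F r := by
  have h1 := Finset.sum_range_succ (fun r : ℕ => F r) P
  have h2 := Finset.sum_range_succ' (fun r : ℕ => F r) P
  have h3 : F (P : ℕ) = F (0 : ℕ) := by simpa using hF 0
  rw [h1, h3] at h2
  push_cast at h2
  exact (add_right_cancel h2).symm

lemma sum_shift_nat {P : ℕ} {F : ℤ → ℂ} (hF : ∀ n, F (n + P) = F n) (x : ℕ) :
    ∑ r ∈ Finset.range P, F (r + x) = ∑ r ∈ Finset.range P, F r := by
  induction x with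
  | zero => simp
  | succ x ih =>
    rw [← ih, ← sum_shift_one (F := fun n => F (n + x))]
    · refine Finset.sum_congr rfl fun r _ => ?_
      congr 1; push_cast; ring
    · intro n; rw [← hF (n + x)]; congr 1; ring

/-- Sums over a full period are invariant under translation. -/
lemma sum_shift {P : ℕ} (hP : 0 < P) {F : ℤ → ℂ} (hF : ∀ n, F (n + P) = F n) (x : ℤ) :
    ∑ r ∈ Finset.range P, F (r + x) = ∑ r ∈ Finset.range P, F r := by
  have hPz : (0 : ℤ) < P := by exact_mod_cast hP
  have hm0 := Int.emod_nonneg x hPz.ne'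
  rw [← sum_shift_nat hF (x % P).toNat]
  refine Finset.sum_congr rfl fun r _ => ?_
  rw [Int.toNat_of_nonneg hm0, ← per_mul hF (r + x % P) (x / P), add_assoc, Int.emod_add_mul_ediv]

/-- Orthogonality of additive characters. -/
lemma sum_ex (P : ℕ) (hP : 0 < P) (a : ℤ) :
    ∑ j ∈ Finset.range P, ex (2 * a * j / P) = if (P : ℤ) ∣ a then (P : ℂ) else 0 := by
  have hP0 : (P : ℂ) ≠ 0 := by exact_mod_cast hP.ne'
  have hpw : ∀ j : ℕ, ex (2 * a * j / P) = ex (2 * a / P) ^ j := by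
    intro j; unfold ex; rw [← Complex.exp_nat_mul]; congr 1; ring
  simp only [hpw]
  split_ifs with h
  · obtain ⟨q, rfl⟩ := h
    have : ex (2 * ((P * q : ℤ) : ℂ) / P) = 1 := by
      rw [← ex_int_two q]; congr 1; push_cast; field_simp
    rw [this]; simp
  · have hne : ex (2 * a / P) ≠ 1 := by
      intro h1
      apply h
      unfold ex at h1
      rw [Complex.exp_eq_one_iff] at h1
      obtain ⟨n, hn⟩ := h1
      refine ⟨n, ?_⟩
      have hpi : (Real.pi : ℂ) ≠ 0 := by exact_mod_cast Real.pi_ne_zero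
      have := Complex.I_ne_zero
      field_simp at hn
      have h3 : (a : ℂ) = P * n := by linear_combination hn
      exact_mod_cast h3
    rw [geom_sum_eq hne]
    have : ex (2 * a / P) ^ P = 1 := by
      rw [← hpw, ← ex_int_two a]; congr 1; field_simp
    simp [this]

/-! ### Square roots -/

lemma sqrtBr_sq (w : ℂ) : sqrtBr w ^ 2 = w := by
  have h1 : (‖w‖ ^ ((1 : ℝ) / 2)) ^ 2 = ‖w‖ := by
    rw [← Real.rpow_natCast, ← Real.rpow_mul (norm_nonneg _)]; norm_num
  have h2 : Complex.exp (Complex.I * (myArg w) / 2) ^ 2 = Complex.exp (Complex.arg w * Complex.I) := by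
    rw [← Complex.exp_nat_mul]
    unfold myArg
    split_ifs with h
    · rw [h]
      have : ((2 : ℕ) : ℂ) * (Complex.I * ((-Real.pi : ℝ) : ℂ) / 2) =
        Real.pi * Complex.I - 2 * Real.pi * Complex.I := by push_cast; ring
      rw [this, Complex.exp_sub, Complex.exp_two_pi_mul_I, div_one]
    · congr 1; push_cast; ring
  unfold sqrtBr
  rw [mul_pow, h2, ← Complex.ofReal_pow, h1, Complex.norm_mul_exp_arg_mul_I]

lemma sqrtBr_re_im (w : ℂ) : (sqrtBr w).re = ‖w‖ ^ ((1 : ℝ) / 2) * Real.cos (myArg w / 2) ∧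
    (sqrtBr w).im = ‖w‖ ^ ((1 : ℝ) / 2) * Real.sin (myArg w / 2) := by
  unfold sqrtBr
  have : Complex.I * (myArg w) / 2 = ((myArg w / 2 : ℝ) : ℂ) * Complex.I := by push_cast; ring
  rw [this, Complex.re_ofReal_mul, Complex.im_ofReal_mul, Complex.exp_ofReal_mul_I_re,
    Complex.exp_ofReal_mul_I_im]
  exact ⟨rfl, rfl⟩

lemma sqrtBr_pos_im {w : ℂ} (h : 0 < w.im) : 0 < (sqrtBr w).re ∧ 0 < (sqrtBr w).im := by
  have hw : 0 < ‖w‖ := norm_pos_iff.2 (by rintro rfl; simp at h)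
  have h1 : 0 < Complex.arg w := by
    rcases (Complex.arg_nonneg_iff.2 h.le).lt_or_eq with h2 | h2
    · exact h2
    · exact absurd (Complex.arg_eq_zero_iff.1 h2.symm).2 h.ne'
  have h2 : Complex.arg w < Real.pi := by
    rcases (Complex.arg_le_pi w).lt_or_eq with h2 | h2
    · exact h2
    · exact absurd (Complex.arg_eq_pi_iff.1 h2).2 h.ne'
  obtain ⟨h3, h4⟩ := sqrtBr_re_im w
  have h5 : myArg w = Complex.arg w := by unfold myArg; rw [if_neg h2.ne]
  have hr := Real.rpow_pos_of_pos hw (1 / 2)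
  rw [h3, h4, h5]
  exact ⟨mul_pos hr (Real.cos_pos_of_mem_Ioo ⟨by linarith, by linarith⟩),
    mul_pos hr (Real.sin_pos_of_pos_of_lt_pi (by linarith) (by linarith))⟩

lemma sqrtBr_neg_im {w : ℂ} (h : w.im < 0) : 0 < (sqrtBr w).re ∧ (sqrtBr w).im < 0 := by
  have hw : 0 < ‖w‖ := norm_pos_iff.2 (by rintro rfl; simp at h)
  have h1 : Complex.arg w < 0 := Complex.arg_neg_iff.2 h
  have h2 : -Real.pi < Complex.arg w := Complex.neg_pi_lt_arg w
  obtain ⟨h3, h4⟩ := sqrtBr_re_im w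
  have h5 : myArg w = Complex.arg w := by
    unfold myArg; rw [if_neg]; intro h; linarith [Real.pi_pos]
  have hr := Real.rpow_pos_of_pos hw (1 / 2)
  rw [h3, h4, h5]
  exact ⟨mul_pos hr (Real.cos_pos_of_mem_Ioo ⟨by linarith, by linarith⟩),
    mul_neg_of_pos_of_neg hr (Real.sin_neg_of_neg_of_neg_pi_lt (by linarith) (by linarith))⟩

lemma sqrtBr_real_pos {x : ℝ} (h : 0 < x) : 0 < (sqrtBr x).re ∧ (sqrtBr x).im = 0 := by
  have hw : 0 < ‖(x : ℂ)‖ := norm_pos_iff.2 (by exact_mod_cast h.ne')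
  obtain ⟨h3, h4⟩ := sqrtBr_re_im x
  have h5 : myArg x = 0 := by
    unfold myArg; rw [Complex.arg_ofReal_of_nonneg h.le, if_neg Real.pi_ne_zero.symm]
  have hr := Real.rpow_pos_of_pos hw (1 / 2)
  rw [h3, h4, h5]
  simp
  positivity

lemma sqrtBr_real_neg {x : ℝ} (h : x < 0) : (sqrtBr x).re = 0 ∧ (sqrtBr x).im < 0 := by
  have hw : 0 < ‖(x : ℂ)‖ := norm_pos_iff.2 (by exact_mod_cast h.ne)
  obtain ⟨h3, h4⟩ := sqrtBr_re_im x
  have h5 : myArg x = -Real.pi := by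
    unfold myArg; rw [Complex.arg_ofReal_of_neg h, if_pos rfl]
  have hr := Real.rpow_pos_of_pos hw (1 / 2)
  rw [h3, h4, h5]
  have : -Real.pi / 2 = -(Real.pi / 2) := by ring
  rw [this, Real.cos_neg, Real.sin_neg, Real.cos_pi_div_two, Real.sin_pi_div_two]
  refine ⟨by ring, by linarith⟩

lemma eq_of_sq {u v : ℂ} (h : u ^ 2 = v ^ 2) (hu : 0 < u.re) (hv : 0 ≤ v.re) : u = v := by
  rcases sq_eq_sq_iff_eq_or_eq_neg.1 h with h | h
  · exact h
  · rw [h] at hu; simp at hu; linarith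

lemma sqrtBr_neg {s : ℂ} (h : 0 < s.im) : sqrtBr (-s) = -Complex.I * sqrtBr s := by
  have h1 := sqrtBr_neg_im (w := -s) (by simpa using h)
  have h2 := sqrtBr_pos_im h
  refine eq_of_sq ?_ h1.1 ?_
  · rw [mul_pow, sqrtBr_sq, sqrtBr_sq]; simp
  · simp; exact h2.2.le

lemma sqrtBr_one : sqrtBr 1 = 1 := by
  have h := sqrtBr_real_pos (x := 1) one_pos
  have := eq_of_sq (u := sqrtBr ((1 : ℝ) : ℂ)) (v := 1) (by rw [sqrtBr_sq]; simp) h.1 (by simp)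
  simpa using this

lemma sqrtBr_neg_one : sqrtBr (-1) = -Complex.I := by
  have h := sqrtBr_real_neg (x := -1) (by norm_num)
  push_cast at h
  rcases sq_eq_sq_iff_eq_or_eq_neg.1 (show sqrtBr (-1) ^ 2 = (-Complex.I) ^ 2 by
    rw [sqrtBr_sq]; simp) with h1 | h1
  · exact h1
  · rw [h1] at h; simp at h; linarith

lemma ex_quarter : ex (-1 / 4) = ((Real.sqrt 2 / 2 : ℝ) : ℂ) * (1 - Complex.I) := by
  unfold ex
  have : (Real.pi : ℂ) * Complex.I * (-1 / 4) = ((-(Real.pi / 4) : ℝ) : ℂ) * Complex.I := by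
    push_cast; ring
  rw [this, Complex.exp_mul_I, ← Complex.ofReal_cos, ← Complex.ofReal_sin, Real.cos_neg,
    Real.sin_neg, Real.cos_pi_div_four, Real.sin_pi_div_four]
  push_cast; ring

lemma ex_half : ex (1 / 2) = Complex.I := by
  unfold ex
  have : (Real.pi : ℂ) * Complex.I * (1 / 2) = Real.pi / 2 * Complex.I := by ring
  rw [this, Complex.exp_pi_div_two_mul_I]

lemma ex_neg_half : ex (-1 / 2) = -Complex.I := by
  have : ex (-1 / 2) * ex (1 / 2) = 1 := by rw [← ex_add, ← ex_zero]; congr 1; ring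
  rw [ex_half] at this
  linear_combination -Complex.I * this + ex (-1 / 2) * Complex.I_sq

lemma rpow_sq {x : ℝ} (hx : 0 < x) : (((x ^ (-(1 : ℝ) / 2) : ℝ) : ℂ)) ^ 2 = (x : ℂ)⁻¹ := by
  rw [← Complex.ofReal_pow, ← Real.rpow_natCast, ← Real.rpow_mul hx.le]
  norm_num [Real.rpow_neg_one]

lemma cpow_sqrtBr {s : ℂ} (hs : 0 < s.im) {x : ℝ} (hx : 0 < x) :
    (-Complex.I * (s / x)) ^ (1 / 2 : ℂ) =
      ex (-1 / 4) * ((x ^ (-(1 : ℝ) / 2) : ℝ) : ℂ) * sqrtBr s := by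
  have hs0 : s ≠ 0 := by rintro rfl; simp at hs
  have hx0 : (x : ℂ) ≠ 0 := by exact_mod_cast hx.ne'
  have hw : -Complex.I * (s / x) ≠ 0 := by simp [hs0, hx0]
  have hre : 0 < (-Complex.I * (s / x)).re := by
    have : (-Complex.I * (s / x)).re = s.im / x := by
      simp [Complex.div_ofReal_im]
    rw [this]; positivity
  have h1 : ((-Complex.I * (s / x)) ^ (1 / 2 : ℂ)) ^ 2 = -Complex.I * (s / x) := by
    rw [← Complex.cpow_nat_mul]; norm_num
  have hq : ex (-1 / 4) ^ 2 = -Complex.I := by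
    rw [← ex_neg_half, sq, ← ex_add]; congr 1; ring
  have hp := sqrtBr_pos_im hs
  refine eq_of_sq ?_ ?_ ?_
  · rw [h1, mul_pow, mul_pow, sqrtBr_sq, rpow_sq hx, hq]; field_simp
  · rw [Complex.cpow_def_of_ne_zero hw, Complex.exp_re]
    refine mul_pos (Real.exp_pos _) ?_
    have : (Complex.log (-Complex.I * (s / x)) * (1 / 2)).im = Complex.arg (-Complex.I * (s / x)) / 2 := by
      rw [show (1 / 2 : ℂ) = ((1 / 2 : ℝ) : ℂ) by push_cast; rfl, Complex.im_mul_ofReal,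
        Complex.log_im]; ring
    rw [this]
    have ha := Complex.abs_arg_lt_pi_div_two_iff.2 (Or.inl hre)
    rw [abs_lt] at ha
    exact Real.cos_pos_of_mem_Ioo ⟨by linarith [Real.pi_pos], by linarith [Real.pi_pos]⟩
  · rw [ex_quarter]
    have hr := Real.rpow_pos_of_pos hx (-(1 : ℝ) / 2)
    have : (((Real.sqrt 2 / 2 : ℝ) : ℂ) * (1 - Complex.I) * ((x ^ (-(1 : ℝ) / 2) : ℝ) : ℂ) * sqrtBr s)
      = ((Real.sqrt 2 / 2 * x ^ (-(1 : ℝ) / 2) : ℝ) : ℂ) * ((1 - Complex.I) * sqrtBr s) := by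
      push_cast; ring
    rw [this, Complex.re_ofReal_mul]
    refine mul_nonneg (by positivity) ?_
    simp
    linarith [hp.1, hp.2]

/-- Sign data of the square root of an automorphy factor. -/
def Vp (x : ℝ) (v : ℂ) : Prop :=
  0 ≤ v.re ∧ ((x < 0 ∧ v.im < 0) ∨ (0 < x ∧ 0 ≤ v.im ∧ 0 < v.re))

lemma Vp_sqrt (g : Matrix (Fin 2) (Fin 2) ℝ) (hg : g 1 0 ≠ 0 ∨ g 1 1 ≠ 0) {z : ℂ} (hz : 0 < z.im) :
    Vp (xEnt g) (sqrtBr (g 1 0 * z + g 1 1)) := by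
  unfold Vp xEnt
  split_ifs with h
  · rw [h]
    simp only [Complex.ofReal_zero, zero_mul, zero_add]
    rcases lt_trichotomy (g 1 1) 0 with h1 | h1 | h1
    · have := sqrtBr_real_neg h1
      exact ⟨this.1.ge, Or.inl ⟨h1, this.2⟩⟩
    · simp_all
    · have := sqrtBr_real_pos h1
      exact ⟨this.1.le, Or.inr ⟨h1, this.2.ge, this.1⟩⟩
  · have him : ((g 1 0 : ℂ) * z + g 1 1).im = g 1 0 * z.im := by simp
    rcases lt_or_gt_of_ne h with h1 | h1
    · have := sqrtBr_neg_im (w := (g 1 0 : ℂ) * z + g 1 1) (by rw [him]; exact mul_neg_of_neg_of_pos h1 hz)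
      exact ⟨this.1.le, Or.inl ⟨h1, this.2⟩⟩
    · have := sqrtBr_pos_im (w := (g 1 0 : ℂ) * z + g 1 1) (by rw [him]; exact mul_pos h1 hz)
      exact ⟨this.1.le, Or.inr ⟨h1, this.2.le, this.1⟩⟩

lemma cocycle_aux {x1 x2 x3 : ℝ} {v1 v2 v3 : ℂ} (h1 : Vp x1 v1) (h2 : Vp x2 v2) (h3 : Vp x3 v3)
    (h : (v1 * v2) ^ 2 = v3 ^ 2) :
    v1 * v2 = ((hilb x1 x2 * hilb (-(x1 * x2)) x3 : ℝ) : ℂ) * v3 := by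
  obtain ⟨p1, c1⟩ := h1
  obtain ⟨p2, c2⟩ := h2
  obtain ⟨p3, c3⟩ := h3
  have key : ∀ ε : ℝ, (ε = 1 ∨ ε = -1) → ((v1 * v2 = (((-ε : ℝ)) : ℂ) * v3) → False) →
      hilb x1 x2 * hilb (-(x1 * x2)) x3 = ε →
      v1 * v2 = ((hilb x1 x2 * hilb (-(x1 * x2)) x3 : ℝ) : ℂ) * v3 := by
    intro ε hε hf he
    rw [he]
    rcases sq_eq_sq_iff_eq_or_eq_neg.1 h with h | h <;> rcases hε with rfl | rfl
    · simpa using h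
    · exact (hf (by simpa using h)).elim
    · exact (hf (by simpa using h)).elim
    · simpa using h
  have hre : ∀ ε : ℝ, v1 * v2 = (ε : ℂ) * v3 → v1.re * v2.re - v1.im * v2.im = ε * v3.re ∧
      v1.re * v2.im + v1.im * v2.re = ε * v3.im := by
    intro ε h
    have a := congrArg Complex.re h
    have b := congrArg Complex.im h
    simpa using And.intro a b
  rcases c1 with ⟨a1, b1⟩ | ⟨a1, b1, d1⟩ <;> rcases c2 with ⟨a2, b2⟩ | ⟨a2, b2, d2⟩
  · have hm : -(x1 * x2) < 0 := by nlinarith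
    rcases c3 with ⟨a3, b3⟩ | ⟨a3, b3, d3⟩
    · refine key 1 (Or.inl rfl) (fun h => ?_) (by simp [hilb, a1, a2, a3, hm])
      obtain ⟨e1, e2⟩ := hre _ h
      nlinarith [mul_nonneg p1 (neg_pos.2 b2).le, mul_nonneg p2 (neg_pos.2 b1).le]
    · refine key (-1) (Or.inr rfl) (fun h => ?_) (by simp [hilb, a1, a2, a3.le, not_lt.2])
      obtain ⟨e1, e2⟩ := hre _ h
      have q1 := mul_nonneg p1 (neg_pos.2 b2).le
      have q2 := mul_nonneg p2 (neg_pos.2 b1).le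
      have q3 : v1.re * v2.im = 0 := by nlinarith
      have q4 : v1.re = 0 := by
        rcases mul_eq_zero.1 q3 with h | h
        · exact h
        · linarith
      rw [q4] at e1
      nlinarith [mul_pos (neg_pos.2 b1) (neg_pos.2 b2)]
  · refine key 1 (Or.inl rfl) (fun h => ?_) (by
      simp [hilb, a2.le, not_lt.2, (mul_neg_of_neg_of_pos a1 a2).le])
    obtain ⟨e1, e2⟩ := hre _ h
    have q1 := mul_nonneg p1 d2.le
    have q2 := mul_nonneg b2 (neg_pos.2 b1).le
    have q3 : v3.re = 0 := by nlinarith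
    have q4 : v1.re * v2.re = 0 := by nlinarith
    have q5 : v1.re = 0 := by
      rcases mul_eq_zero.1 q4 with h | h
      · exact h
      · linarith
    rw [q5] at e2
    rcases c3 with ⟨a3, b3⟩ | ⟨a3, b3, d3⟩
    · nlinarith [mul_pos (neg_pos.2 b1) d2]
    · linarith
  · refine key 1 (Or.inl rfl) (fun h => ?_) (by
      simp [hilb, a1.le, not_lt.2, (mul_neg_of_pos_of_neg a1 a2).le])
    obtain ⟨e1, e2⟩ := hre _ h
    have q1 := mul_nonneg p2 d1.le
    have q2 := mul_nonneg b1 (neg_pos.2 b2).le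
    have q3 : v3.re = 0 := by nlinarith
    have q4 : v1.re * v2.re = 0 := by nlinarith
    have q5 : v2.re = 0 := by
      rcases mul_eq_zero.1 q4 with h | h
      · linarith
      · exact h
    rw [q5] at e2
    rcases c3 with ⟨a3, b3⟩ | ⟨a3, b3, d3⟩
    · nlinarith [mul_pos (neg_pos.2 b2) d1]
    · linarith
  · have hm : -(x1 * x2) < 0 := by nlinarith
    have q1 := mul_nonneg d1.le b2
    have q2 := mul_nonneg d2.le b1
    rcases c3 with ⟨a3, b3⟩ | ⟨a3, b3, d3⟩
    · refine key (-1) (Or.inr rfl) (fun h => ?_) (by simp [hilb, a1.le, a3, a1, a2, not_lt.2])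
      obtain ⟨e1, e2⟩ := hre _ h
      nlinarith
    · refine key 1 (Or.inl rfl) (fun h => ?_) (by simp [hilb, a1.le, a3.le, not_lt.2])
      obtain ⟨e1, e2⟩ := hre _ h
      have q3 : v1.re * v2.im = 0 := by nlinarith
      have q4 : v2.im = 0 := by
        rcases mul_eq_zero.1 q3 with h | h
        · linarith
        · exact h
      rw [q4] at e1
      nlinarith [mul_pos d1 d2]

/-- Rao's cocycle measures the failure of `√` to be multiplicative on automorphy factors. -/
lemma rao_cocycle (g₁ g₂ : Matrix (Fin 2) (Fin 2) ℝ) {z z' : ℂ} (hz : 0 < z.im) (hz' : 0 < z'.im)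
    (h1 : g₁ 1 0 ≠ 0 ∨ g₁ 1 1 ≠ 0) (h2 : g₂ 1 0 ≠ 0 ∨ g₂ 1 1 ≠ 0)
    (h3 : (g₁ * g₂) 1 0 ≠ 0 ∨ (g₁ * g₂) 1 1 ≠ 0)
    (hj : ((g₁ 1 0 : ℂ) * z' + g₁ 1 1) * (g₂ 1 0 * z + g₂ 1 1) =
      ((g₁ * g₂) 1 0 : ℝ) * z + ((g₁ * g₂) 1 1 : ℝ)) :
    sqrtBr ((g₁ 1 0 : ℂ) * z' + g₁ 1 1) * sqrtBr (g₂ 1 0 * z + g₂ 1 1) =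
      (raoC g₁ g₂ : ℂ) * sqrtBr (((g₁ * g₂) 1 0 : ℝ) * z + ((g₁ * g₂) 1 1 : ℝ)) := by
  refine cocycle_aux (Vp_sqrt g₁ h1 hz') (Vp_sqrt g₂ h2 hz) (Vp_sqrt _ h3 hz) ?_
  rw [mul_pow, sqrtBr_sq, sqrtBr_sq, sqrtBr_sq, hj]

/-! ### The theta function on the theta group -/

/-- `th3 w = Σ e^{π i n² w}`. -/
def th3 (w : ℂ) : ℂ := ∑' n : ℤ, ex ((n : ℂ) ^ 2 * w)

lemma im_aff_pos {c d : ℤ} (hc : 0 < c) {w : ℂ} (hw : 0 < w.im) : 0 < ((c : ℂ) * w + d).im := by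
  have : ((c : ℂ) * w + d).im = c * w.im := by simp
  rw [this]
  have : (0 : ℝ) < c := by exact_mod_cast hc
  positivity

lemma mobius_eq {a b c d : ℤ} (hdet : a * d - b * c = 1) (hc : 0 < c) {w : ℂ} (hw : 0 < w.im) :
    ((a : ℂ) * w + b) / (c * w + d) = a / c - 1 / (c * (c * w + d)) := by
  have hs0 : (c : ℂ) * w + d ≠ 0 := by
    intro h; have := im_aff_pos (d := d) hc hw; rw [h] at this; simp at this
  have hc0 : (c : ℂ) ≠ 0 := by exact_mod_cast hc.ne'
  have hd : (a : ℂ) * d - b * c = 1 := by exact_mod_cast hdet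
  have h1 : 1 / ((c : ℂ) * (c * w + d)) * (c * w + d) = 1 / c := by
    rw [one_div, mul_inv, mul_assoc, inv_mul_cancel₀ hs0, mul_one, one_div]
  rw [div_eq_iff hs0, sub_mul, h1]
  field_simp
  linear_combination -hd

lemma gauss_hat {P : ℕ} (hP : 0 < P) {a b d : ℤ} (hdet : a * d - b * P = 1) (hac : Even (a * P))
    (hbd : Even (b * d)) (k : ℤ) :
    ∑ r ∈ Finset.range P, ex (a * ((r : ℤ) : ℂ) ^ 2 / P) * ex (2 * k * r / P) =
      ex (-(d * (k : ℂ) ^ 2) / P) * ∑ r ∈ Finset.range P, ex (a * ((r : ℤ) : ℂ) ^ 2 / P) := by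
  have hP0 : (P : ℂ) ≠ 0 := by exact_mod_cast hP.ne'
  have hd : (a : ℂ) * d = 1 + b * P := by
    have : (a : ℂ) * d - b * P = 1 := by exact_mod_cast hdet
    linear_combination this
  have hF : ∀ n : ℤ, ex (a * ((n + P : ℤ) : ℂ) ^ 2 / P) = ex (a * (n : ℂ) ^ 2 / P) := by
    intro n
    obtain ⟨q, hq⟩ := hac
    have hq' : (a : ℂ) * P = q + q := by exact_mod_cast hq
    refine ex_eq_of_sub (a * n + q) ?_
    push_cast
    field_simp
    linear_combination (P : ℂ) * hq'
  have hs := sum_shift hP (F := fun n : ℤ => ex (a * (n : ℂ) ^ 2 / P)) hF (d * k)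
  rw [← hs, Finset.mul_sum]
  refine Finset.sum_congr rfl fun r _ => ?_
  rw [← ex_add, ← ex_add]
  obtain ⟨q, hq⟩ := hbd
  have hq' : (b : ℂ) * d = q + q := by exact_mod_cast hq
  refine ex_eq_of_sub (-(b * r * k) - q * k ^ 2) ?_
  push_cast
  field_simp
  linear_combination (-2 * r * k - d * k ^ 2) * hd - (P : ℂ) * k ^ 2 * hq'

lemma gauss_prod {P : ℕ} (hP : 0 < P) {a b d : ℤ} (hdet : a * d - b * P = 1) (hac : Even (a * P))
    (hbd : Even (b * d)) :
    (∑ r ∈ Finset.range P, ex (a * ((r : ℤ) : ℂ) ^ 2 / P)) *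
      (∑ k ∈ Finset.range P, ex (-(d * ((k : ℤ) : ℂ) ^ 2) / P)) = P := by
  rw [Finset.mul_sum]
  have h1 : ∀ k ∈ Finset.range P, (∑ r ∈ Finset.range P, ex (a * ((r : ℤ) : ℂ) ^ 2 / P)) *
      ex (-(d * ((k : ℤ) : ℂ) ^ 2) / P) =
      ∑ r ∈ Finset.range P, ex (a * ((r : ℤ) : ℂ) ^ 2 / P) * ex (2 * (k : ℤ) * r / P) := by
    intro k _
    rw [gauss_hat hP hdet hac hbd, mul_comm]
  rw [Finset.sum_congr rfl h1, Finset.sum_comm]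
  have h2 : ∀ r ∈ Finset.range P, ∑ k ∈ Finset.range P,
      ex (a * ((r : ℤ) : ℂ) ^ 2 / P) * ex (2 * (k : ℤ) * r / P) = if r = 0 then (P : ℂ) else 0 := by
    intro r hr
    rw [← Finset.mul_sum]
    have h3 := sum_ex P hP r
    have h4 : ∑ k ∈ Finset.range P, ex (2 * ((k : ℤ) : ℂ) * r / P) =
        ∑ j ∈ Finset.range P, ex (2 * ((r : ℤ) : ℂ) * j / P) := by
      refine Finset.sum_congr rfl fun k _ => ?_
      congr 1; push_cast; ring
    rw [h4, h3]
    by_cases h0 : r = 0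
    · subst h0; simp [ex_zero]
    · rw [if_neg h0, if_neg, mul_zero]
      intro h5
      have := Nat.le_of_dvd (Nat.pos_of_ne_zero h0) (by exact_mod_cast h5)
      have := Finset.mem_range.1 hr
      omega
  rw [Finset.sum_congr rfl h2]
  simp [hP.ne']

lemma th3_pos {a b c d : ℤ} (hdet : a * d - b * c = 1) (hac : Even (a * c))
    (hbd : Even (b * d)) (hc : 0 < c) {w : ℂ} (hw : 0 < w.im) :
    th3 ((a * w + b) / (c * w + d)) =
      ex (-1 / 4) * (gaussG d c)⁻¹ * sqrtBr (c * w + d) * th3 w := by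
  have hs := im_aff_pos (d := d) hc hw
  rw [mobius_eq hdet hc hw]
  obtain ⟨P, rfl⟩ := Int.eq_ofNat_of_zero_le hc.le
  have hP : 0 < P := by exact_mod_cast hc
  have hPR : (0 : ℝ) < P := by exact_mod_cast hc
  have hP0 : (P : ℂ) ≠ 0 := by exact_mod_cast hP.ne'
  simp only [Int.cast_natCast] at hs ⊢
  set s : ℂ := (P : ℂ) * w + d with hsdef
  have hs0 : s ≠ 0 := by intro h; rw [h] at hs; simp at hs
  have hτ : 0 < (s / P).im := by
    have : (s / P).im = s.im / P := by
      rw [show (P : ℂ) = ((P : ℝ) : ℂ) by simp, Complex.div_ofReal_im]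
    rw [this]; positivity
  have hF : ∀ n : ℤ, ex (a * ((n + P : ℤ) : ℂ) ^ 2 / P) = ex (a * (n : ℂ) ^ 2 / P) := by
    intro n
    obtain ⟨q, hq⟩ := hac
    have hq' : (a : ℂ) * P = q + q := by exact_mod_cast hq
    refine ex_eq_of_sub (a * n + q) ?_
    push_cast
    field_simp
    linear_combination (P : ℂ) * hq'
  have hp := poisson 0 P (Or.inl rfl) hP (fun n : ℤ => ex (a * (n : ℂ) ^ 2 / P)) hF (s / P) hτ
  have hL : th3 (a / P - 1 / (P * s)) = ∑' n : ℤ, ex (a * (n : ℂ) ^ 2 / P) * (n : ℂ) ^ 0 *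
      ex (-(n : ℂ) ^ 2 / ((P : ℂ) ^ 2 * (s / P))) := by
    unfold th3
    refine tsum_congr fun n => ?_
    rw [pow_zero, mul_one, ← ex_add]
    congr 1
    field_simp
    ring
  rw [hL, hp]
  set g : ℂ := ∑ r ∈ Finset.range P, ex (a * ((r : ℤ) : ℂ) ^ 2 / P) with hg
  have hR : ∑' k : ℤ, (∑ r ∈ Finset.range P, ex (a * ((r : ℤ) : ℂ) ^ 2 / P) * ex (2 * k * r / P)) *
      (k : ℂ) ^ 0 * ex (k ^ 2 * (s / P)) = g * th3 w := by
    unfold th3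
    rw [← tsum_mul_left]
    refine tsum_congr fun k => ?_
    rw [gauss_hat hP hdet hac hbd, ← hg, pow_zero, mul_one, mul_right_comm, ← ex_add, mul_comm]
    congr 2
    rw [hsdef]
    field_simp
    ring
  rw [hR]
  have hx := cpow_sqrtBr hs hPR
  rw [Complex.ofReal_natCast] at hx
  rw [hx]
  have hgp := gauss_prod hP hdet hac hbd
  rw [← hg] at hgp
  have hG : gaussG d P = (((P : ℝ) ^ (-(1 : ℝ) / 2) : ℝ) : ℂ) *
      ∑ k ∈ Finset.range P, ex (-(d * ((k : ℤ) : ℂ) ^ 2) / P) := by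
    unfold gaussG
    simp only [Int.natAbs_natCast]
    congr 1
    refine Finset.sum_congr rfl fun n _ => ?_
    unfold ex; congr 1; push_cast; ring
  have hsq := rpow_sq hPR
  rw [Complex.ofReal_natCast] at hsq
  set rr : ℂ := (((P : ℝ) ^ (-(1 : ℝ) / 2) : ℝ) : ℂ) with hrr
  set gd : ℂ := ∑ k ∈ Finset.range P, ex (-(d * ((k : ℤ) : ℂ) ^ 2) / P) with hgd
  have hinv : (gaussG d P)⁻¹ = rr * g := by
    rw [hG]
    refine inv_eq_of_mul_eq_one_right ?_
    have : rr * gd * (rr * g) = rr ^ 2 * (g * gd) := by ring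
    rw [this, hsq, hgp]
    field_simp
  rw [hinv]
  ring

lemma th3_add_even (w : ℂ) {b : ℤ} (hb : Even b) : th3 (w + b) = th3 w := by
  unfold th3
  refine tsum_congr fun n => ?_
  obtain ⟨q, rfl⟩ := hb
  refine ex_eq_of_sub (n ^ 2 * q) ?_
  push_cast; ring

/-- The transformation law of the theta function on the theta group. -/
lemma th3_trans {a b c d : ℤ} (hdet : a * d - b * c = 1) (hac : Even (a * c))
    (hbd : Even (b * d)) {w : ℂ} (hw : 0 < w.im) :
    th3 ((a * w + b) / (c * w + d)) =
      lamTheta !![a, b; c, d] * sqrtBr (c * w + d) * th3 w := by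
  rcases lt_trichotomy c 0 with hc | hc | hc
  · have h := th3_pos (a := -a) (b := -b) (c := -c) (d := -d) (by linarith) (by simpa using hac)
      (by simpa using hbd) (by linarith) hw
    have hs := im_aff_pos (c := -c) (d := -d) (by linarith) hw
    have hl : lamTheta !![a, b; c, d] = ex (1 / 4) * (gaussG d c)⁻¹ := by
      have hc' : (c : ℝ) < 0 := by exact_mod_cast hc
      simp [lamTheta, mX, betaTilde, toR, hc.ne, Real.sign_of_neg hc', ex]
      left; congr 1; ring
    have hg : gaussG (-d) (-c) = gaussG d c := by
      unfold gaussG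
      rw [Int.natAbs_neg]
      congr 1
      refine Finset.sum_congr rfl fun n _ => ?_
      congr 1
      push_cast
      rw [div_neg, ← neg_div]; congr 1; ring
    have hsq := sqrtBr_neg hs
    have e1 : ((-a : ℤ) * w + (-b : ℤ)) / ((-c : ℤ) * w + (-d : ℤ)) = (a * w + b) / (c * w + d) := by
      push_cast
      rw [← neg_div_neg_eq]; congr 1 <;> ring
    have e2 : -(((-c : ℤ) : ℂ) * w + (-d : ℤ)) = c * w + d := by push_cast; ring
    rw [e1, hg] at h
    rw [e2] at hsq
    rw [h, hl, hsq]
    have : ex (-1 / 4) = ex (1 / 4) * -Complex.I := by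
      rw [← ex_neg_half, ← ex_add]; congr 1; ring
    rw [this]; ring
  · subst hc
    have had : a * d = 1 := by linarith
    rcases Int.isUnit_iff.1 (IsUnit.of_mul_eq_one_right a had) with rfl | rfl
    · have : a = 1 := by linarith
      subst this
      have hl : lamTheta !![1, b; 0, 1] = 1 := by
        simp [lamTheta, mX, betaTilde, toR, Real.sign_one]
      rw [hl]
      simp only [Int.cast_zero, Int.cast_one, zero_mul, zero_add, one_mul, sqrtBr_one, div_one]
      exact th3_add_even w (by simpa using hbd)
    · have : a = -1 := by linarith
      subst this
      have hl : lamTheta !![-1, b; 0, -1] = Complex.I := by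
        rw [← ex_half]
        simp [lamTheta, mX, betaTilde, toR, Real.sign_neg, Real.sign_one, ex]
        congr 1; ring
      rw [hl]
      simp only [Int.cast_zero, Int.cast_one, Int.cast_neg, zero_mul, zero_add, sqrtBr_neg_one]
      have : (-1 * w + (b : ℂ)) / -1 = w + (-b : ℤ) := by push_cast; ring
      rw [this, th3_add_even w (by simpa using hbd)]
      have := Complex.I_sq
      linear_combination (th3 w) * this
  · rw [th3_pos hdet hac hbd hc hw]
    have hl : lamTheta !![a, b; c, d] = ex (-1 / 4) * (gaussG d c)⁻¹ := by
      have hc' : (0 : ℝ) < c := by exact_mod_cast hc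
      simp [lamTheta, mX, betaTilde, toR, hc.ne', Real.sign_of_pos hc', ex]
      left; congr 1; ring
    rw [hl]

/-! ### Theta series with character over odd integers -/

/-- `Th e ψ w = Σ_{m odd} ψ(m) m^e e^{π i m² w / 4}`. -/
def Th (e : ℕ) (ψ : ℤ → ℂ) (w : ℂ) : ℂ :=
  ∑' m : ℤ, (if Odd m then ψ m else 0) * (m : ℂ) ^ e * ex ((m : ℂ) ^ 2 * w / 4)

lemma odd_sq {m : ℤ} (h : Odd m) : ∃ j : ℤ, m ^ 2 = 1 + 8 * j := by
  have := Int.sq_mod_four_eq_one_of_odd h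
  obtain ⟨k, rfl⟩ := h
  obtain ⟨q, hq⟩ := Int.even_mul_succ_self k
  exact ⟨q, by linarith⟩

lemma average {M N : ℕ} (hM : 0 < M) (hN : 0 < N) {W : ℤ → ℂ} (hW : ∀ n, W (n + M) = W n)
    (y : ℤ) (u : ℤ → ℤ) (h : ∀ (m : ℤ) (j : ℕ), W (m + y * j) = W m * ex (2 * u m * j / N)) :
    ∑ m ∈ Finset.range M, W m = ∑ m ∈ Finset.range M, if (N : ℤ) ∣ u m then W m else 0 := by
  have hN0 : (N : ℂ) ≠ 0 := by exact_mod_cast hN.ne'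
  have h1 : (N : ℂ) * ∑ m ∈ Finset.range M, W m =
      ∑ j ∈ Finset.range N, ∑ m ∈ Finset.range M, W (m + y * j) := by
    simp only [sum_shift hM hW]
    simp
  rw [Finset.sum_comm] at h1
  have h2 : ∀ m ∈ Finset.range M, ∑ j ∈ Finset.range N, W (m + y * j) =
      (N : ℂ) * if (N : ℤ) ∣ u m then W m else 0 := by
    intro m _
    simp only [h]
    rw [← Finset.mul_sum, sum_ex N hN]
    split_ifs
    · ring
    · simp
  rw [Finset.sum_congr rfl h2, ← Finset.mul_sum] at h1
  exact mul_left_cancel₀ hN0 h1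

/-- The basic even Gauss sum. -/
def gA (a : ℤ) (P : ℕ) : ℂ :=
  ∑ m ∈ Finset.range (4 * P), if Even (m : ℤ) then ex (a * ((m : ℤ) : ℂ) ^ 2 / (4 * P)) else 0

lemma sum_char_aux {N P : ℕ} (hP : 0 < P) (hNo : Odd N) (hN2 : (2 * N ^ 2) ∣ P) {a : ℤ}
    (ha : IsCoprime a (N : ℤ)) (G : ℤ → ℂ) (hG : ∀ m, G (m + (2 * N : ℕ)) = G m)
    (hG0 : ∀ m, Odd m → G m = 0) :
    ∑ m ∈ Finset.range (4 * P), G m * ex (a * ((m : ℤ) : ℂ) ^ 2 / (4 * P)) =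
      G 0 * ∑ m ∈ Finset.range (4 * P), if Even (m : ℤ) ∧ (N : ℤ) ∣ m then
        ex (a * ((m : ℤ) : ℂ) ^ 2 / (4 * P)) else 0 := by
  have hN : 0 < N := hNo.pos
  obtain ⟨q, rfl⟩ := hN2
  have hq : q ≠ 0 := by rintro rfl; simp at hP
  have hq0 : (q : ℂ) ≠ 0 := by exact_mod_cast hq
  have hN0 : (N : ℂ) ≠ 0 := by exact_mod_cast hN.ne'
  have hW : ∀ n : ℤ, G (n + (4 * (2 * N ^ 2 * q) : ℕ)) *
      ex (a * ((n + (4 * (2 * N ^ 2 * q) : ℕ) : ℤ) : ℂ) ^ 2 / (4 * (2 * N ^ 2 * q : ℕ))) =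
      G n * ex (a * (n : ℂ) ^ 2 / (4 * (2 * N ^ 2 * q : ℕ))) := by
    intro n
    have h1 := per_mul hG n (4 * N * q)
    have h2 : n + ((2 * N : ℕ) : ℤ) * (4 * N * q) = n + (4 * (2 * N ^ 2 * q) : ℕ) := by
      push_cast; ring
    rw [h2] at h1
    rw [h1]
    congr 1
    refine ex_eq_of_sub (a * n + a * (4 * N ^ 2 * q)) ?_
    push_cast
    field_simp
    ring
  rw [average (by positivity) hN (W := fun n : ℤ => G n * ex (a * (n : ℂ) ^ 2 / (4 * (2 * N ^ 2 * q : ℕ))))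
    hW (4 * N * q) (fun m => a * (m / 2)), Finset.mul_sum]
  · refine Finset.sum_congr rfl fun m _ => ?_
    by_cases hm : Even (m : ℤ)
    · obtain ⟨l, hl⟩ := hm
      have hl2 : (m : ℤ) / 2 = l := by omega
      have hiff : (N : ℤ) ∣ a * ((m : ℤ) / 2) ↔ (N : ℤ) ∣ m := by
        rw [hl2, hl]
        constructor
        · intro h
          exact dvd_add (ha.symm.dvd_of_dvd_mul_left h) (ha.symm.dvd_of_dvd_mul_left h)
        · intro h
          have h2 : IsCoprime (N : ℤ) 2 := by
            rw [Int.isCoprime_iff_gcd_eq_one]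
            have : Nat.Coprime N 2 := Nat.coprime_two_right.2 hNo
            exact_mod_cast this
          exact Dvd.dvd.mul_left (h2.dvd_of_dvd_mul_left (by rw [two_mul]; exact h)) a
      have hE : Even (m : ℤ) := ⟨l, hl⟩
      by_cases hd : (N : ℤ) ∣ m
      · rw [if_pos (hiff.2 hd), if_pos ⟨hE, hd⟩]
        congr 1
        have h3 := hiff.2 hd
        rw [hl2] at h3
        obtain ⟨v, hv⟩ := ha.symm.dvd_of_dvd_mul_left h3
        have h1 := per_mul hG 0 v
        rw [← h1, hl, hv]
        congr 1
        push_cast; ring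
      · rw [if_neg (fun h => hd (hiff.1 h)), if_neg (fun h => hd h.2), mul_zero]
    · have ho : Odd (m : ℤ) := Int.not_even_iff_odd.1 hm
      simp only [hG0 _ ho, zero_mul, ite_self, hm, false_and, if_false, mul_zero]
  · intro m j
    have h1 := per_mul hG m (2 * q * j)
    have h2 : m + ((2 * N : ℕ) : ℤ) * (2 * q * j) = m + 4 * N * q * j := by
      push_cast; ring
    rw [h2] at h1
    rw [h1]
    by_cases hm : Even m
    · obtain ⟨l, hl⟩ := hm
      have hl2 : m / 2 = l := by omega
      rw [mul_assoc (G m), ← ex_add, hl2, hl]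
      congr 1
      refine ex_eq_of_sub (a * q * j ^ 2) ?_
      push_cast
      field_simp
      ring
    · rw [hG0 m (Int.not_even_iff_odd.1 hm)]; simp

lemma sum_char {N P : ℕ} (hP : 0 < P) (hNo : Odd N) (hN2 : (2 * N ^ 2) ∣ P) {a : ℤ}
    (ha : IsCoprime a (N : ℤ)) (G : ℤ → ℂ) (hG : ∀ m, G (m + (2 * N : ℕ)) = G m)
    (hG0 : ∀ m, Odd m → G m = 0) :
    ∑ m ∈ Finset.range (4 * P), G m * ex (a * ((m : ℤ) : ℂ) ^ 2 / (4 * P)) = G 0 * gA a P := by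
  rw [sum_char_aux hP hNo hN2 ha G hG hG0]
  have h := sum_char_aux hP hNo hN2 ha (fun m => if Even m then 1 else 0) (by
    intro m
    have : Even (m + (2 * N : ℕ)) ↔ Even m := by
      push_cast; simp [Int.even_add]
    simp only [this]) (by
    intro m hm; rw [if_neg (Int.not_even_iff_odd.2 hm)])
  simp only [Even.zero, if_true, one_mul] at h
  rw [← h]
  unfold gA
  congr 1
  refine Finset.sum_congr rfl fun m _ => ?_
  split_ifs <;> simp

lemma hat_char {N P : ℕ} (hP : 0 < P) (hNo : Odd N) (hN2 : (2 * N ^ 2) ∣ P) {a h v : ℤ}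
    (hah : a * h + 8 * P * v = 1) (ψ : ℤ → ℂ) (hψ : ∀ m, ψ (m + N) = ψ m) (k : ℤ) :
    ∑ r ∈ Finset.range (4 * P), ((if Odd (r : ℤ) then ψ r else 0) * ex (a * ((r : ℤ) : ℂ) ^ 2 / (4 * P))) *
      ex (2 * k * r / (4 * P : ℕ)) =
      if Odd k then ex (-(h * (k : ℂ) ^ 2) / (4 * P)) * ψ (-(h * k)) * gA a P else 0 := by
  have hN : 0 < N := hNo.pos
  have hP0 : (P : ℂ) ≠ 0 := by exact_mod_cast hP.ne'
  have hPe : Even (P : ℤ) := by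
    obtain ⟨q, rfl⟩ := hN2
    exact ⟨N ^ 2 * q, by push_cast; ring⟩
  have haN : IsCoprime a (N : ℤ) := by
    obtain ⟨q, rfl⟩ := hN2
    exact ⟨h, 16 * N * q * v, by push_cast at hah; linarith⟩
  have hao : Odd (a * h) := ⟨-(4 * P * v), by linarith⟩
  obtain ⟨hao, hho⟩ := Int.odd_mul.1 hao
  have hψ2 : ∀ m : ℤ, (if Odd (m + (2 * N : ℕ)) then ψ (m + (2 * N : ℕ)) else 0) =
      if Odd m then ψ m else 0 := by
    intro m
    have : Odd (m + (2 * N : ℕ)) ↔ Odd m := by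
      push_cast; simp [Int.odd_add]
    have h2 := per_mul hψ m 2
    rw [show m + (N : ℤ) * 2 = m + (2 * N : ℕ) by push_cast; ring] at h2
    simp only [this, h2]
  have hψP : ∀ m : ℤ, ∀ j : ℤ, (if Odd (m + 2 * P * j) then ψ (m + 2 * P * j) else 0) =
      if Odd m then ψ m else 0 := by
    intro m j
    obtain ⟨q, rfl⟩ := hN2
    have := per_mul (F := fun m => if Odd m then ψ m else 0) hψ2 m (2 * N * q * j)
    rw [← this]
    have e : m + ((2 * N : ℕ) : ℤ) * (2 * N * q * j) = m + 2 * (2 * N ^ 2 * q : ℕ) * j := by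
      push_cast; ring
    rw [e]
  set T : ℤ → ℂ := fun r => ((if Odd r then ψ r else 0) * ex (a * (r : ℂ) ^ 2 / (4 * P))) *
      ex (2 * k * r / (4 * P : ℕ)) with hT
  have hTper : ∀ n, T (n + (4 * P : ℕ)) = T n := by
    intro n
    simp only [hT]
    have h1 := hψP n 2
    rw [show n + 2 * (P : ℤ) * 2 = n + (4 * P : ℕ) by push_cast; ring] at h1
    rw [h1, mul_assoc (if Odd n then ψ n else 0), mul_assoc (if Odd n then ψ n else 0), ← ex_add, ← ex_add]
    congr 1
    refine ex_eq_of_sub (a * n + 2 * a * P + k) ?_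
    push_cast
    field_simp
    ring
  have hgoal : ∑ r ∈ Finset.range (4 * P), T r =
      if Odd k then ex (-(h * (k : ℂ) ^ 2) / (4 * P)) * ψ (-(h * k)) * gA a P else 0 := by
    split_ifs with hk
    · rw [← sum_shift (by positivity) hTper (-(h * k))]
      have h1 := sum_char hP hNo hN2 haN (fun m => if Odd (m + -(h * k)) then ψ (m + -(h * k)) else 0)
        (by
          intro m
          rw [← hψ2 (m + -(h * k))]
          rw [show m + (2 * N : ℕ) + -(h * k) = m + -(h * k) + (2 * N : ℕ) by ring])
        (by
          intro m hm
          rw [if_neg]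
          rw [Int.not_odd_iff_even]
          exact hm.add_odd (hho.mul hk).neg)
      simp only [zero_add] at h1
      rw [if_pos (hho.mul hk).neg] at h1
      rw [mul_assoc, ← h1, Finset.mul_sum]
      refine Finset.sum_congr rfl fun r _ => ?_
      simp only [hT]
      rw [mul_left_comm, mul_assoc, ← ex_add, ← ex_add]
      congr 1
      have hah' : (a : ℂ) * h + 8 * P * v = 1 := by exact_mod_cast hah
      refine ex_eq_of_sub (2 * v * r * k - v * h * k ^ 2) ?_
      push_cast
      field_simp
      linear_combination (h * (k : ℂ) ^ 2 - 2 * r * k) * hah'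
    · have h1 := sum_shift (by positivity) hTper (2 * P)
      have h2 : ∀ r ∈ Finset.range (4 * P), T ((r : ℤ) + 2 * P) = - T r := by
        intro r _
        simp only [hT]
        have h1 := hψP r 1
        rw [mul_one] at h1
        rw [h1]
        by_cases hr : Odd (r : ℤ)
        · rw [mul_assoc (if Odd (r : ℤ) then ψ r else 0), mul_assoc (if Odd (r : ℤ) then ψ r else 0),
            ← ex_add, ← ex_add, ← mul_neg]
          congr 1
          have ho : Odd (a * (r + P) + k) :=
            (hao.mul (hr.add_even hPe)).add_even (Int.not_odd_iff_even.1 hk)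
          have : -ex (a * ((r : ℤ) : ℂ) ^ 2 / (4 * P) + 2 * k * ((r : ℤ) : ℂ) / ((4 * P : ℕ) : ℂ)) =
              ex (a * ((r : ℤ) : ℂ) ^ 2 / (4 * P) + 2 * k * ((r : ℤ) : ℂ) / ((4 * P : ℕ) : ℂ)) *
                ex ((a * (r + P) + k : ℤ) : ℂ) := by
            rw [ex_odd ho]; ring
          rw [this, ← ex_add]
          congr 1
          push_cast
          field_simp
          ring
        · simp [hr]
      rw [Finset.sum_congr rfl h2, Finset.sum_neg_distrib] at h1
      exact self_eq_neg.1 h1.symm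
  rw [← hgoal]
  refine Finset.sum_congr rfl fun r _ => ?_
  simp [hT]

/-- A completely multiplicative function on the integers of period `N` and parity `e`. -/
def IsChar (N e : ℕ) (ψ : ℤ → ℂ) : Prop :=
  (∀ m, ψ (m + N) = ψ m) ∧ (∀ x y, ψ (x * y) = ψ x * ψ y) ∧ ψ (-1) = (-1) ^ e

lemma Th_pos {a b c d : ℤ} (hdet : a * d - b * c = 1) (hc : 0 < c) (h2 : 2 ∣ c) :
    ∃ K : ℂ, ∀ (N e : ℕ) (ψ : ℤ → ℂ) (w : ℂ), Odd N → ((N : ℤ) ^ 2 ∣ c) → (e = 0 ∨ e = 1) →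
      IsChar N e ψ → 0 < w.im → Th e ψ ((a * w + b) / (c * w + d)) =
        K * sqrtBr (c * w + d) ^ (2 * e + 1) * ψ d * Th e ψ w := by
  have hao : Odd a := by
    obtain ⟨q, rfl⟩ := h2
    have : Odd (a * d) := ⟨b * q, by linarith⟩
    exact (Int.odd_mul.1 this).1
  have hcop : IsCoprime a (8 * c) := by
    refine IsCoprime.mul_right ?_ ⟨d, -b, by linarith⟩
    have : IsCoprime a 2 := by
      obtain ⟨q, rfl⟩ := hao
      exact ⟨1, -q, by ring⟩
    have := this.pow_right (n := 3)
    norm_num at this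
    exact this
  obtain ⟨h, v, hhv⟩ := hcop
  set f : ℤ := -(h * b) - 8 * v * d with hf
  have hhd : h = d + c * f := by rw [hf]; linear_combination d * hhv - h * hdet
  refine ⟨ex (-1 / 4) * (((4 * c : ℝ) ^ (-(1 : ℝ) / 2) : ℝ) : ℂ) * gA a c.toNat * ex (-f / 4), ?_⟩
  intro N e ψ w hNo hNc he ⟨hper, hmul, hneg⟩ hw
  have hs := im_aff_pos (d := d) hc hw
  rw [mobius_eq hdet hc hw]
  have hN2 : (2 * N ^ 2) ∣ c.toNat := by
    have hcp : Nat.Coprime 2 (N ^ 2) := (Nat.coprime_two_left.2 hNo.pow)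
    refine hcp.mul_dvd_of_dvd_of_dvd ?_ ?_
    · omega
    · zify; rw [Int.toNat_of_nonneg hc.le]; exact hNc
  obtain ⟨P, rfl⟩ := Int.eq_ofNat_of_zero_le hc.le
  have hP : 0 < P := by exact_mod_cast hc
  have hPR : (0 : ℝ) < 4 * P := by positivity
  have hP0 : (P : ℂ) ≠ 0 := by exact_mod_cast hP.ne'
  simp only [Int.cast_natCast, Int.toNat_natCast] at hs hN2 ⊢
  set s : ℂ := (P : ℂ) * w + d with hsdef
  have hs0 : s ≠ 0 := by intro h; rw [h] at hs; simp at hs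
  have hτ : 0 < (s / (4 * P : ℕ)).im := by
    have : (s / (4 * P : ℕ)).im = s.im / (4 * P) := by
      rw [show ((4 * P : ℕ) : ℂ) = ((4 * P : ℝ) : ℂ) by push_cast; ring, Complex.div_ofReal_im]
    rw [this]; positivity
  have hah : a * h + 8 * P * v = 1 := by linarith
  have hF : ∀ n : ℤ, (if Odd (n + (4 * P : ℕ)) then ψ (n + (4 * P : ℕ)) else 0) *
      ex (a * ((n + (4 * P : ℕ) : ℤ) : ℂ) ^ 2 / (4 * P)) =
      (if Odd n then ψ n else 0) * ex (a * (n : ℂ) ^ 2 / (4 * P)) := by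
    intro n
    have e1 : ex (a * ((n + (4 * P : ℕ) : ℤ) : ℂ) ^ 2 / (4 * P)) = ex (a * (n : ℂ) ^ 2 / (4 * P)) := by
      refine ex_eq_of_sub (a * n + 2 * a * P) ?_
      push_cast
      field_simp
      ring
    have e2 : Odd (n + (4 * P : ℕ)) ↔ Odd n := by
      push_cast
      rw [Int.odd_add]
      have : Even (4 * (P : ℤ)) := ⟨2 * P, by ring⟩
      simp [this]
    have e3 : ψ (n + (4 * P : ℕ)) = ψ n := by
      obtain ⟨q, rfl⟩ := hN2
      rw [← per_mul hper n (8 * N * q)]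
      congr 1; push_cast; ring
    rw [e1, e3]; simp only [e2]
  have hp := poisson e (4 * P) he (by positivity) (fun n : ℤ => (if Odd n then ψ n else 0) *
    ex (a * (n : ℂ) ^ 2 / (4 * P))) hF (s / (4 * P : ℕ)) hτ
  have hL : Th e ψ (a / P - 1 / (P * s)) = ∑' n : ℤ, (if Odd n then ψ n else 0) *
      ex (a * (n : ℂ) ^ 2 / (4 * P)) * (n : ℂ) ^ e *
      ex (-(n : ℂ) ^ 2 / (((4 * P : ℕ) : ℂ) ^ 2 * (s / (4 * P : ℕ)))) := by
    unfold Th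
    refine tsum_congr fun n => ?_
    rw [mul_right_comm _ (ex _), mul_assoc _ (ex _), ← ex_add]
    congr 2
    push_cast
    field_simp
    ring
  have hψh : ψ h = ψ d := by
    have hNP : (N : ℤ) ∣ P := (Dvd.intro_left ((N : ℤ) ^ 1) (by ring : (N : ℤ) ^ 1 * N = N ^ 2)).trans hNc
    obtain ⟨q, hq⟩ := hNP
    rw [hhd, hq, mul_assoc, per_mul hper]
  rw [hL, hp]
  have hR : ∑' k : ℤ, (∑ r ∈ Finset.range (4 * P), (if Odd (r : ℤ) then ψ r else 0) *
      ex (a * ((r : ℤ) : ℂ) ^ 2 / (4 * P)) * ex (2 * k * r / (4 * P : ℕ))) *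
      (k : ℂ) ^ e * ex (k ^ 2 * (s / (4 * P : ℕ))) =
      ((-1) ^ e * ψ d * gA a P * ex (-f / 4)) * Th e ψ w := by
    unfold Th
    rw [← tsum_mul_left]
    refine tsum_congr fun k => ?_
    rw [hat_char hP hNo hN2 hah ψ hper]
    by_cases hk : Odd k
    · rw [if_pos hk, if_pos hk]
      have e1 : ψ (-(h * k)) = (-1) ^ e * ψ d * ψ k := by
        rw [show -(h * k) = (-1) * h * k by ring, hmul, hmul, hneg, hψh]
      have e2 : ex (-(h * (k : ℂ) ^ 2) / (4 * P)) * ex (k ^ 2 * (s / (4 * P : ℕ))) =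
          ex (-f / 4) * ex ((k : ℂ) ^ 2 * w / 4) := by
        rw [← ex_add, ← ex_add]
        obtain ⟨j, hj⟩ := odd_sq hk
        have hj' : (k : ℂ) ^ 2 = 1 + 8 * j := by exact_mod_cast hj
        have hh' : (h : ℂ) = d + P * f := by exact_mod_cast hhd
        refine ex_eq_of_sub (-(f * j)) ?_
        rw [hsdef, hh']
        push_cast
        field_simp
        linear_combination (-(f : ℂ) * P) * hj'
      rw [e1]
      linear_combination ((-1) ^ e * ψ d * ψ k * gA a P * (k : ℂ) ^ e) * e2
    · simp [hk]
  rw [hR]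
  have hx := cpow_sqrtBr hs hPR
  have e0 : ((4 * P : ℕ) : ℂ) = ((4 * P : ℝ) : ℂ) := by push_cast; ring
  rw [e0, hx]
  have e1 : sqrtBr s ^ (2 * e + 1) = s ^ e * sqrtBr s := by
    rw [pow_succ, pow_mul, sqrtBr_sq]
  have e2 : (-(((4 * P : ℝ) : ℂ) * (s / ((4 * P : ℝ) : ℂ)))) ^ e = (-1) ^ e * s ^ e := by
    rw [← e0, mul_div_cancel₀, neg_pow]
    push_cast; simp [hP0]
  have e3 : ((-1 : ℂ) ^ e) * (-1) ^ e = 1 := by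
    rw [← mul_pow]; norm_num
  rw [e1, e2]
  linear_combination (s ^ e * (ex (-1 / 4) * (((4 * P : ℝ) ^ (-(1 : ℝ) / 2) : ℝ) : ℂ) * sqrtBr s) *
    (ψ d * gA a P * ex (-f / 4)) * Th e ψ w) * e3

lemma Th_trans {a b c d : ℤ} (hdet : a * d - b * c = 1) (h2 : 2 ∣ c) :
    ∃ K : ℂ, ∀ (N e : ℕ) (ψ : ℤ → ℂ) (w : ℂ), Odd N → ((N : ℤ) ^ 2 ∣ c) → (e = 0 ∨ e = 1) →
      IsChar N e ψ → 0 < w.im → Th e ψ ((a * w + b) / (c * w + d)) =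
        K * sqrtBr (c * w + d) ^ (2 * e + 1) * ψ d * Th e ψ w := by
  have hsgn : ∀ e : ℕ, ((-1 : ℂ) ^ e) * (-1) ^ e = 1 := by
    intro e; rw [← mul_pow]; norm_num
  have hI : ∀ e : ℕ, Complex.I ^ (2 * e + 1) = (-1) ^ e * Complex.I := by
    intro e; rw [pow_succ, pow_mul, Complex.I_sq]
  rcases lt_trichotomy c 0 with hc | hc | hc
  · obtain ⟨K, hK⟩ := Th_pos (a := -a) (b := -b) (c := -c) (d := -d) (by linarith) (by linarith)
      (by simpa using h2)
    refine ⟨K * Complex.I, ?_⟩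
    intro N e ψ w hNo hNc he hψ hw
    have h := hK N e ψ w hNo (by simpa using hNc) he hψ hw
    have hs := im_aff_pos (c := -c) (d := -d) (by linarith) hw
    have hsq := sqrtBr_neg hs
    have e1 : ((-a : ℤ) * w + (-b : ℤ)) / ((-c : ℤ) * w + (-d : ℤ)) = (a * w + b) / (c * w + d) := by
      push_cast
      rw [← neg_div_neg_eq]; congr 1 <;> ring
    have e2 : -(((-c : ℤ) : ℂ) * w + (-d : ℤ)) = c * w + d := by push_cast; ring
    rw [e2] at hsq
    have e3 : sqrtBr (((-c : ℤ) : ℂ) * w + (-d : ℤ)) = Complex.I * sqrtBr (c * w + d) := by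
      rw [hsq]
      linear_combination sqrtBr (((-c : ℤ) : ℂ) * w + (-d : ℤ)) * Complex.I_sq
    have e4 : ψ (-d) = (-1) ^ e * ψ d := by
      rw [show -d = (-1) * d by ring, hψ.2.1, hψ.2.2]
    rw [e1, e3, e4, mul_pow, hI] at h
    rw [h]
    linear_combination (K * Complex.I * sqrtBr (c * w + d) ^ (2 * e + 1) * ψ d * Th e ψ w) * hsgn e
  · subst hc
    have hshift : ∀ (e : ℕ) (ψ : ℤ → ℂ) (w : ℂ) (x : ℤ), Th e ψ (w + x) = ex (x / 4) * Th e ψ w := by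
      intro e ψ w x
      unfold Th
      rw [← tsum_mul_left]
      refine tsum_congr fun m => ?_
      by_cases hm : Odd m
      · obtain ⟨j, hj⟩ := odd_sq hm
        have hj' : (m : ℂ) ^ 2 = 1 + 8 * j := by exact_mod_cast hj
        have : ex ((m : ℂ) ^ 2 * (w + x) / 4) = ex (x / 4) * ex ((m : ℂ) ^ 2 * w / 4) := by
          rw [← ex_add]
          refine ex_eq_of_sub (j * x) ?_
          push_cast
          linear_combination (x / 4 : ℂ) * hj'
        rw [this]; ring
      · simp [hm]
    have had : a * d = 1 := by linarith
    rcases Int.isUnit_iff.1 (IsUnit.of_mul_eq_one_right a had) with rfl | rfl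
    · have : a = 1 := by linarith
      subst this
      refine ⟨ex (b / 4), ?_⟩
      intro N e ψ w hNo hNc he hψ hw
      have h1 : ψ 1 = 1 := by
        rw [show (1 : ℤ) = (-1) * (-1) by norm_num, hψ.2.1, hψ.2.2, hsgn]
      have : (((1 : ℤ) : ℂ) * w + b) / ((0 : ℤ) * w + (1 : ℤ)) = w + b := by push_cast; simp
      rw [this, hshift, h1]
      simp [sqrtBr_one]
    · have : a = -1 := by linarith
      subst this
      refine ⟨ex (-b / 4) * Complex.I, ?_⟩
      intro N e ψ w hNo hNc he hψ hw
      have : (((-1 : ℤ) : ℂ) * w + b) / ((0 : ℤ) * w + (-1 : ℤ)) = w + ((-b : ℤ) : ℂ) := by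
        push_cast
        rw [zero_mul, zero_add, div_neg, div_one]; ring
      rw [this, hshift, hψ.2.2]
      have e5 : ((0 : ℤ) : ℂ) * w + ((-1 : ℤ) : ℂ) = -1 := by push_cast; ring
      rw [e5, sqrtBr_neg_one, neg_pow, hI, pow_succ (-1 : ℂ), pow_mul]
      push_cast
      have := hsgn e
      simp only [neg_one_sq, one_pow, one_mul]
      linear_combination (-ex (-b / 4) * Th e ψ w) * this +
        (ex (-b / 4) * Th e ψ w * ((-1) ^ e * (-1) ^ e)) * Complex.I_sq
  · exact Th_pos hdet hc h2

/-- The constant function one. -/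
def one1 : ℤ → ℂ := fun _ => 1

lemma th3_U {w : ℂ} (hw : 0 < w.im) : th3 (w / (1 - w)) = sqrtBr (1 - w) * Th 0 one1 w := by
  have hw1 : 0 < (w - 1).im := by simpa using hw
  have h0 : w - 1 ≠ 0 := by intro h; rw [h] at hw1; simp at hw1
  have h0' : 1 - w ≠ 0 := by intro h; apply h0; linear_combination -h
  have hτ : 0 < ((w - 1) / 4).im := by
    have : ((w - 1) / 4).im = (w - 1).im / 4 := by
      rw [show (4 : ℂ) = ((4 : ℝ) : ℂ) by norm_num, Complex.div_ofReal_im]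
    rw [this]; linarith
  have hp := poisson 0 2 (Or.inl rfl) (by norm_num) (fun n : ℤ => ex n) (by
    intro n
    exact ex_eq_of_sub 1 (by push_cast; ring)) ((w - 1) / 4) hτ
  have hL : th3 (w / (1 - w)) = ∑' n : ℤ, ex n * (n : ℂ) ^ 0 *
      ex (-(n : ℂ) ^ 2 / (((2 : ℕ) : ℂ) ^ 2 * ((w - 1) / 4))) := by
    unfold th3
    refine tsum_congr fun n => ?_
    rw [pow_zero, mul_one, ← ex_add]
    obtain ⟨q, hq⟩ := Int.even_mul_succ_self n
    have hq' : (n : ℂ) * (n + 1) = q + q := by exact_mod_cast hq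
    refine ex_eq_of_sub (-q) ?_
    push_cast
    have e1 : w / (1 - w) = -1 - 1 / (w - 1) := by
      have : 1 - w = -(w - 1) := by ring
      rw [this]; field_simp; ring
    have e2 : -(n : ℂ) ^ 2 / (2 ^ 2 * ((w - 1) / 4)) = -(n : ℂ) ^ 2 * (1 / (w - 1)) := by
      field_simp; ring
    rw [e1, e2]
    linear_combination (-1 : ℂ) * hq'
  have hR : ∑' k : ℤ, (∑ r ∈ Finset.range 2, ex ((r : ℤ) : ℂ) * ex (2 * k * r / (2 : ℕ))) *
      (k : ℂ) ^ 0 * ex (k ^ 2 * ((w - 1) / 4)) = 2 * ex (-1 / 4) * Th 0 one1 w := by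
    unfold Th
    rw [← tsum_mul_left]
    refine tsum_congr fun k => ?_
    have e1 : ∑ r ∈ Finset.range 2, ex ((r : ℤ) : ℂ) * ex (2 * k * r / (2 : ℕ)) = 1 - ex k := by
      rw [Finset.sum_range_succ, Finset.sum_range_one]
      have h1 : ex ((1 : ℕ) : ℤ) = -1 := ex_odd (by norm_num)
      rw [h1]
      have h2 : (2 * (k : ℂ) * ((1 : ℕ) : ℂ) / (2 : ℕ)) = k := by push_cast; ring
      rw [h2]
      simp [ex_zero]
      ring
    rw [e1]
    by_cases hk : Odd k
    · rw [ex_odd hk, if_pos hk]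
      obtain ⟨j, hj⟩ := odd_sq hk
      have hj' : (k : ℂ) ^ 2 = 1 + 8 * j := by exact_mod_cast hj
      have : ex ((k : ℂ) ^ 2 * ((w - 1) / 4)) = ex (-1 / 4) * ex ((k : ℂ) ^ 2 * w / 4) := by
        rw [← ex_add]
        refine ex_eq_of_sub (-j) ?_
        push_cast
        linear_combination (-1 / 4 : ℂ) * hj'
      rw [this]; simp only [one1]; ring
    · rw [ex_even (Int.not_odd_iff_even.1 hk), if_neg hk]; simp
  have hx := cpow_sqrtBr hw1 (x := 4) (by norm_num)
  have hq : ((4 : ℝ) ^ (-(1 : ℝ) / 2) : ℝ) = 1 / 2 := by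
    rw [show (4 : ℝ) = 2 ^ (2 : ℝ) by norm_num, ← Real.rpow_mul (by norm_num)]
    norm_num [Real.rpow_neg_one]
  have hs := sqrtBr_neg hw1
  rw [show -(w - 1) = 1 - w by ring] at hs
  have h4 : ex (-1 / 4) * ex (-1 / 4) = -Complex.I := by
    rw [← ex_add, ← ex_neg_half]; congr 1; ring
  rw [hL, hp, hR, hs]
  rw [hq] at hx
  push_cast at hx
  rw [hx, pow_zero]
  linear_combination (sqrtBr (w - 1) * Th 0 one1 w) * h4

lemma Th_ne : Th 0 one1 Complex.I ≠ 0 := by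
  have hterm : ∀ m : ℤ, (if Odd m then one1 m else 0) * (m : ℂ) ^ 0 *
      ex ((m : ℂ) ^ 2 * Complex.I / 4) =
      (((if Odd m then Real.exp (-(Real.pi * (m : ℝ) ^ 2 / 4)) else 0) : ℝ) : ℂ) := by
    intro m
    by_cases hm : Odd m
    · simp only [hm, if_true, one1, pow_zero, mul_one, one_mul, ex]
      rw [Complex.ofReal_exp]
      congr 1
      push_cast
      linear_combination (Real.pi * (m : ℂ) ^ 2 / 4) * Complex.I_sq
    · simp [hm]
  unfold Th
  simp only [hterm]
  rw [← Complex.ofReal_tsum]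
  have hsum : Summable (fun m : ℤ => Real.exp (-(Real.pi * (m : ℝ) ^ 2 / 4))) := by
    have h := (summable_jacobiTheta₂_term_iff 0 (Complex.I / 4)).2 (by simp)
    refine h.norm.congr fun m => ?_
    rw [norm_jacobiTheta₂_term]
    congr 1
    simp
    ring
  have hsum2 : Summable (fun m : ℤ => if Odd m then Real.exp (-(Real.pi * (m : ℝ) ^ 2 / 4)) else 0) := by
    refine hsum.of_nonneg_of_le (fun m => ?_) fun m => ?_
    · split_ifs <;> positivity
    · split_ifs
      · exact le_rfl
      · positivity
  have hpos := hsum2.tsum_pos (fun m => by split_ifs <;> positivity) 1 (by simp; positivity)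
  exact_mod_cast hpos.ne'

lemma raoC_sq (g₁ g₂ : Matrix (Fin 2) (Fin 2) ℝ) : (raoC g₁ g₂ : ℂ) * raoC g₁ g₂ = 1 := by
  have : raoC g₁ g₂ * raoC g₁ g₂ = 1 := by
    unfold raoC hilb
    split_ifs <;> norm_num
  exact_mod_cast this

lemma den_ne {a b c d : ℤ} (hdet : a * d - b * c = 1) {w : ℂ} (hw : 0 < w.im) :
    (c : ℂ) * w + d ≠ 0 := by
  intro h
  have h1 := congrArg Complex.im h
  simp at h1
  rcases h1 with h1 | h1
  · rw [h1] at h hdet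
    simp at h
    rw [h] at hdet; simp at hdet
  · exact hw.ne' h1

lemma im_mobius {a b c d : ℤ} (hdet : a * d - b * c = 1) {w : ℂ} (hw : 0 < w.im) :
    0 < (((a : ℂ) * w + b) / (c * w + d)).im := by
  have h0 := den_ne hdet hw
  have hdet' : (a : ℝ) * d - b * c = 1 := by exact_mod_cast hdet
  have hn : 0 < Complex.normSq ((c : ℂ) * w + d) := Complex.normSq_pos.2 h0
  have : (((a : ℂ) * w + b) / (c * w + d)).im = w.im / Complex.normSq ((c : ℂ) * w + d) := by
    rw [Complex.div_im]
    simp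
    linear_combination (w.im / Complex.normSq ((c : ℂ) * w + d)) * hdet'
  rw [this]; positivity

lemma sqrtBr_ne {s : ℂ} (h : s ≠ 0) : sqrtBr s ≠ 0 := by
  intro h1
  apply h
  rw [← sqrtBr_sq s, h1]; simp

/-- The multiplier. -/
def nu (a b c d : ℤ) : ℂ :=
  (raoC (toR !![(1 : ℤ), 0; -1, 1]) (toR !![a, b; c, d]) : ℂ) *
    (raoC (toR (!![(1 : ℤ), 0; -1, 1] * !![a, b; c, d])) (toR !![(1 : ℤ), 0; 1, 1]) : ℂ) *
    lamTheta (!![(1 : ℤ), 0; -1, 1] * !![a, b; c, d] * !![(1 : ℤ), 0; 1, 1])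

lemma S_eq (a b c d : ℤ) : !![(1 : ℤ), 0; -1, 1] * !![a, b; c, d] * !![(1 : ℤ), 0; 1, 1] =
    !![a + b, b; c + d - a - b, d - b] := by
  ext i j
  fin_cases i <;> fin_cases j <;> simp [Matrix.mul_apply, Fin.sum_univ_two] <;> ring

lemma S_even {a b c d : ℤ} (hdet : a * d - b * c = 1) (h2 : 2 ∣ c) :
    Even ((a + b) * (c + d - a - b)) ∧ Even (b * (d - b)) := by
  obtain ⟨q, rfl⟩ := h2
  have : Odd (a * d) := ⟨b * q, by linarith⟩
  obtain ⟨ha, hd⟩ := Int.odd_mul.1 this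
  rcases Int.even_or_odd b with hb | hb
  · refine ⟨Even.mul_left ?_ _, hb.mul_right _⟩
    have : 2 * q + d - a - b = 2 * q + (d - a) - b := by ring
    rw [this]
    exact ((even_two_mul q).add (hd.sub_odd ha)).sub hb
  · exact ⟨(ha.add_odd hb).mul_right _, (hd.sub_odd hb).mul_left _⟩

lemma Th_one {a b c d : ℤ} (hdet : a * d - b * c = 1) (h2 : 2 ∣ c) {w : ℂ} (hw : 0 < w.im) :
    Th 0 one1 ((a * w + b) / (c * w + d)) = nu a b c d * sqrtBr (c * w + d) * Th 0 one1 w := by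
  have hdetC : (a : ℂ) * d - b * c = 1 := by exact_mod_cast hdet
  have h0 := den_ne hdet hw
  have hw' := im_mobius hdet hw
  have hu1 : (1 : ℂ) - w ≠ 0 := by
    intro h; have := congrArg Complex.im h; simp at this; exact hw.ne' this
  have hUw : 0 < (w / (1 - w)).im := by
    have := im_mobius (a := 1) (b := 0) (c := -1) (d := 1) (by norm_num) hw
    have e : (((1 : ℤ) : ℂ) * w + (0 : ℤ)) / ((-1 : ℤ) * w + (1 : ℤ)) = w / (1 - w) := by
      push_cast; congr 1 <;> ring
    rwa [e] at this
  set w' := ((a : ℂ) * w + b) / (c * w + d) with hwd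
  set u := w / (1 - w) with hu
  have hw1 : (1 : ℂ) - w' ≠ 0 := by
    intro h; have := congrArg Complex.im h; simp at this; exact hw'.ne' this
  have hX : ((c : ℂ) - a) * w + (d - b) = (1 - w') * (c * w + d) := by
    rw [hwd, sub_mul (1 : ℂ), div_mul_cancel₀ _ h0]; ring
  have hX0 : ((c : ℂ) - a) * w + (d - b) ≠ 0 := by
    rw [hX]; exact mul_ne_zero hw1 h0
  have hdetS : (a + b) * (d - b) - b * (c + d - a - b) = 1 := by linarith
  have hS0 := den_ne hdetS hUw
  have hwS : w' / (1 - w') = (((a + b : ℤ) : ℂ) * u + b) / (((c + d - a - b : ℤ) : ℂ) * u + (d - b : ℤ)) := by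
    have e1 : w' / (1 - w') = (a * w + b) / (((c : ℂ) - a) * w + (d - b)) := by
      rw [hX, ← mul_div_mul_right w' (1 - w') h0]
      congr 1
      rw [hwd, div_mul_cancel₀ _ h0]
    have e2 : (((a + b : ℤ) : ℂ) * u + b) = (a * w + b) / (1 - w) := by
      rw [hu]; push_cast; field_simp; ring
    have e3 : ((c + d - a - b : ℤ) : ℂ) * u + (d - b : ℤ) =
        (((c : ℂ) - a) * w + (d - b)) / (1 - w) := by
      rw [hu]; push_cast; field_simp; ring
    rw [e1, e2, e3, div_div_div_cancel_right₀ hu1]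
  obtain ⟨hE1, hE2⟩ := S_even hdet h2
  have hth := th3_trans hdetS hE1 hE2 hUw
  rw [← hwS, th3_U hw', hu, th3_U hw, ← hu] at hth
  have hcd : (c : ℝ) ≠ 0 ∨ (d : ℝ) ≠ 0 := by
    by_contra h
    push Not at h
    have h1 : c = 0 := by exact_mod_cast h.1
    have h2 : d = 0 := by exact_mod_cast h.2
    rw [h1, h2] at hdet; simp at hdet
  have hcd2 : (c : ℝ) - a ≠ 0 ∨ (d : ℝ) - b ≠ 0 := by
    by_contra h
    push Not at h
    have h1 : c = a := by have := h.1; rw [sub_eq_zero] at this; exact_mod_cast this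
    have h2 : d = b := by have := h.2; rw [sub_eq_zero] at this; exact_mod_cast this
    rw [h1, h2] at hdet; linarith
  have hcd3 : (c : ℝ) + d - a - b ≠ 0 ∨ (d : ℝ) - b ≠ 0 := by
    by_contra h
    push Not at h
    have h2 := h.2
    have h1 : (c : ℝ) - a = 0 := by linarith [h.1]
    rcases hcd2 with h3 | h3
    · exact h3 h1
    · exact h3 h2
  have p1 : (toR !![(1 : ℤ), 0; -1, 1] * toR !![a, b; c, d]) 1 0 = (c : ℝ) - a := by
    simp [toR, Matrix.mul_apply, Fin.sum_univ_two]; ring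
  have p2 : (toR !![(1 : ℤ), 0; -1, 1] * toR !![a, b; c, d]) 1 1 = (d : ℝ) - b := by
    simp [toR, Matrix.mul_apply, Fin.sum_univ_two]; ring
  have p3 : (toR (!![(1 : ℤ), 0; -1, 1] * !![a, b; c, d])) 1 0 = (c : ℝ) - a := by
    simp [toR, Matrix.mul_apply, Fin.sum_univ_two]; ring
  have p4 : (toR (!![(1 : ℤ), 0; -1, 1] * !![a, b; c, d])) 1 1 = (d : ℝ) - b := by
    simp [toR, Matrix.mul_apply, Fin.sum_univ_two]; ring
  have q0 : (toR !![(1 : ℤ), 0; 1, 1]) 0 0 = 1 := by simp [toR]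
  have q1 : (toR !![(1 : ℤ), 0; 1, 1]) 0 1 = 0 := by simp [toR]
  have q2 : (toR !![(1 : ℤ), 0; 1, 1]) 1 0 = 1 := by simp [toR]
  have q3 : (toR !![(1 : ℤ), 0; 1, 1]) 1 1 = 1 := by simp [toR]
  have p5 : (toR (!![(1 : ℤ), 0; -1, 1] * !![a, b; c, d]) * toR !![(1 : ℤ), 0; 1, 1]) 1 0 =
      (c : ℝ) + d - a - b := by
    rw [Matrix.mul_apply, Fin.sum_univ_two, p3, p4, q0, q2]; ring
  have p6 : (toR (!![(1 : ℤ), 0; -1, 1] * !![a, b; c, d]) * toR !![(1 : ℤ), 0; 1, 1]) 1 1 =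
      (d : ℝ) - b := by
    rw [Matrix.mul_apply, Fin.sum_univ_two, p3, p4, q1, q3]; ring
  have r1 : (toR !![(1 : ℤ), 0; -1, 1]) 1 0 = -1 := by simp [toR]
  have r2 : (toR !![(1 : ℤ), 0; -1, 1]) 1 1 = 1 := by simp [toR]
  have r3 : (toR !![a, b; c, d]) 1 0 = c := by simp [toR]
  have r4 : (toR !![a, b; c, d]) 1 1 = d := by simp [toR]
  have hr1 := rao_cocycle (toR !![(1 : ℤ), 0; -1, 1]) (toR !![a, b; c, d]) hw hw'
    (by rw [r1]; left; norm_num) (by rw [r3, r4]; exact hcd) (by rw [p1, p2]; exact hcd2)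
    (by rw [p1, p2, r1, r2, r3, r4]; push_cast; rw [hX]; ring)
  have hr2 := rao_cocycle (toR (!![(1 : ℤ), 0; -1, 1] * !![a, b; c, d])) (toR !![(1 : ℤ), 0; 1, 1]) hUw hw
    (by rw [p3, p4]; exact hcd2) (by rw [q2]; left; norm_num) (by rw [p5, p6]; exact hcd3)
    (by rw [p5, p6, p3, p4, q2, q3, hu]; push_cast; field_simp; ring)
  rw [p1, p2, r1, r2, r3, r4] at hr1
  rw [p5, p6, p3, p4, q2, q3] at hr2
  push_cast at hr1 hr2 hth
  rw [show (-1 : ℂ) * w' + 1 = 1 - w' by ring] at hr1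
  have hDF : sqrtBr (1 * u + 1) * sqrtBr (1 - w) = 1 := by
    have e : (1 : ℂ) * u + 1 = (1 - w)⁻¹ := by
      rw [hu]; field_simp; ring
    have i1 : (1 - w).im < 0 := by simpa using hw
    have i2 : 0 < (1 * u + 1).im := by simpa using hUw
    have k1 := sqrtBr_neg_im i1
    have k2 := sqrtBr_pos_im i2
    have hsq : (sqrtBr (1 * u + 1) * sqrtBr (1 - w)) ^ 2 = 1 := by
      rw [mul_pow, sqrtBr_sq, sqrtBr_sq, e, inv_mul_cancel₀ hu1]
    refine eq_of_sq (by rw [hsq]; norm_num) ?_ (by simp)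
    rw [Complex.mul_re]
    nlinarith [mul_pos k1.1 k2.1, mul_pos k2.2 (neg_pos.2 k1.2)]
  have hA0 := sqrtBr_ne hw1
  have hρ1 := raoC_sq (toR !![(1 : ℤ), 0; -1, 1]) (toR !![a, b; c, d])
  have hρ2 := raoC_sq (toR (!![(1 : ℤ), 0; -1, 1] * !![a, b; c, d])) (toR !![(1 : ℤ), 0; 1, 1])
  unfold nu
  rw [S_eq]
  generalize (raoC (toR !![(1 : ℤ), 0; -1, 1]) (toR !![a, b; c, d]) : ℂ) = ρ₁ at *
  generalize (raoC (toR (!![(1 : ℤ), 0; -1, 1] * !![a, b; c, d])) (toR !![(1 : ℤ), 0; 1, 1]) : ℂ) = ρ₂ at *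
  generalize lamTheta !![a + b, b; c + d - a - b, d - b] = l at *
  apply mul_left_cancel₀ hA0
  generalize sqrtBr (1 - w') = A at *
  generalize sqrtBr (1 - w) = F at *
  generalize sqrtBr (1 * u + 1) = D at *
  generalize sqrtBr (c * w + d) = B at *
  generalize sqrtBr (((c : ℂ) - a) * w + (d - b)) = X at *
  generalize sqrtBr (((c : ℂ) + d - a - b) * u + (d - b)) = E at *
  generalize Th 0 one1 w' = T' at *
  generalize Th 0 one1 w = T at *
  have hE : E = ρ₂ * (X * D) := by rw [hr2]; linear_combination (-E) * hρ2
  have hX' : X = ρ₁ * (A * B) := by rw [hr1]; linear_combination (-X) * hρ1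
  rw [hth, hE, hX']
  linear_combination (l * ρ₂ * ρ₁ * A * B * T) * hDF

lemma isChar_one : IsChar 1 0 one1 := by
  refine ⟨fun _ => rfl, fun _ _ => by simp [one1], by simp [one1]⟩

lemma Th_final {a b c d : ℤ} (hdet : a * d - b * c = 1) (h2 : 2 ∣ c) (N e : ℕ) (ψ : ℤ → ℂ) {w : ℂ}
    (hN : Odd N) (hNc : (N : ℤ) ^ 2 ∣ c) (he : e = 0 ∨ e = 1) (hψ : IsChar N e ψ) (hw : 0 < w.im) :
    Th e ψ ((a * w + b) / (c * w + d)) =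
      nu a b c d * sqrtBr (c * w + d) ^ (2 * e + 1) * ψ d * Th e ψ w := by
  obtain ⟨K, hK⟩ := Th_trans hdet h2
  have h1 := hK 1 0 one1 Complex.I odd_one (by simp) (Or.inl rfl) isChar_one (by simp)
  rw [Th_one hdet h2 (by simp)] at h1
  have hs := sqrtBr_ne (den_ne hdet (w := Complex.I) (by simp))
  have hKnu : nu a b c d = K := by
    have h3 : nu a b c d * (sqrtBr (c * Complex.I + d) * Th 0 one1 Complex.I) =
        K * (sqrtBr (c * Complex.I + d) * Th 0 one1 Complex.I) := by
      simp only [one1, mul_zero, zero_add, pow_one, mul_one] at h1 ⊢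
      rw [← mul_assoc, h1, mul_assoc]
    exact mul_right_cancel₀ (mul_ne_zero hs Th_ne) h3
  rw [hKnu]
  exact hK N e ψ w hN hNc he hψ hw

/-- A Dirichlet character as a function on the integers. -/
def chi0 {N : ℕ} (χ : DirichletCharacter ℂ N) (m : ℤ) : ℂ := χ (m : ZMod N)

lemma isChar_chi {N e : ℕ} (χ : DirichletCharacter ℂ N) (h : χ (-1 : ZMod N) = (-1) ^ e) :
    IsChar N e (chi0 χ) := by
  refine ⟨fun m => by simp [chi0], fun x y => by simp [chi0], ?_⟩
  simp only [chi0]; push_cast; exact h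

lemma chi_two {N : ℕ} (hN : Odd N) (χ : DirichletCharacter ℂ N) : χ (2 : ZMod N) ≠ 0 := by
  have h : IsUnit ((2 : ℕ) : ZMod N) := by
    rw [ZMod.isUnit_iff_coprime]; exact Nat.coprime_two_left.2 hN
  have : IsUnit (χ (2 : ZMod N)) := by
    have := h.map χ
    simpa using this
  exact this.ne_zero

lemma chi_shift {N : ℕ} (hN : Odd N) (χ : DirichletCharacter ℂ N) (n : ℤ) :
    χ (2 : ZMod N) * χ ((n + ((N : ℤ) + 1) / 2 : ℤ) : ZMod N) = chi0 χ (2 * n + 1) := by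
  rw [← map_mul]
  unfold chi0
  congr 1
  obtain ⟨k, hk⟩ := hN
  have h1 : ((N : ℤ) + 1) / 2 = k + 1 := by omega
  have h2 : ((2 * k + 1 : ℕ) : ZMod N) = 0 := by rw [← hk]; simp
  rw [h1]
  push_cast at h2 ⊢
  linear_combination h2

lemma Th_reindex (e : ℕ) (ψ : ℤ → ℂ) (w : ℂ) :
    Th e ψ w = ∑' n : ℤ, ψ (2 * n + 1) * (2 * n + 1 : ℂ) ^ e * ex (w * ((n : ℂ) + 1 / 2) ^ 2) := by
  unfold Th
  have hinj : Function.Injective (fun n : ℤ => 2 * n + 1) := by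
    intro x y h; simp only at h; omega
  rw [← hinj.tsum_eq]
  · refine tsum_congr fun n => ?_
    have : Odd (2 * n + 1) := ⟨n, rfl⟩
    rw [if_pos this]
    push_cast
    congr 2
    ring
  · intro m hm
    rw [Function.mem_support] at hm
    by_cases ho : Odd m
    · obtain ⟨k, hk⟩ := ho
      exact ⟨k, hk.symm⟩
    · simp [ho] at hm

lemma theta_half {N : ℕ} (hN : Odd N) (χ : DirichletCharacter ℂ N) (t : ℕ) (z : ℂ) :
    χ (2 : ZMod N) * thetaFHalfT χ t z = Th 0 (chi0 χ) (t * z) := by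
  unfold thetaFHalfT
  rw [Th_reindex, ← tsum_mul_left]
  refine tsum_congr fun n => ?_
  rw [← mul_assoc, chi_shift hN, pow_zero, mul_one]
  unfold ex
  congr 2
  ring

lemma theta_three {N : ℕ} (hN : Odd N) (χ : DirichletCharacter ℂ N) (t : ℕ) (z : ℂ) :
    2 * χ (2 : ZMod N) * thetaFThreeHalfT χ t z = Th 1 (chi0 χ) (t * z) := by
  unfold thetaFThreeHalfT
  rw [Th_reindex, ← tsum_mul_left]
  refine tsum_congr fun n => ?_
  rw [← chi_shift hN]
  unfold ex
  have : Complex.I * (Real.pi : ℂ) * t * z * ((n : ℂ) + 1 / 2) ^ 2 =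
    Real.pi * Complex.I * (t * z * ((n : ℂ) + 1 / 2) ^ 2) := by ring
  rw [this]
  ring

theorem statement18 (N t : ℕ) (hN : 1 ≤ N) (hNodd : Odd N) (ht : 1 ≤ t)
    (χ : DirichletCharacter ℂ N) (hχ : χ.IsPrimitive)
    (a b c d : ℚ) (hdet : a * d - b * c = 1)
    (a' b' c' d' : ℤ)
    (ha : (a' : ℚ) = a) (hb : (b' : ℚ) = t * b) (hc : (c' : ℚ) = c / t)
    (hd : (d' : ℚ) = d) (hdet' : a' * d' - b' * c' = 1)
    (hc2 : (2 : ℤ) ∣ c') (hN2 : ((N : ℤ)) ^ 2 ∣ c')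
    (z : ℂ) (hz : 0 < z.im) :
    ∀ R' S : Matrix (Fin 2) (Fin 2) ℤ,
      R' = !![a', b'; c', d'] →
      S = !![(1 : ℤ), 0; -1, 1] * R' * !![(1 : ℤ), 0; 1, 1] →
      (Even (S 0 0 * S 1 0) ∧ Even (S 0 1 * S 1 1)) ∧
      (χ (-1 : ZMod N) = 1 →
        thetaFHalfT χ t (((a : ℂ) * z + (b : ℂ)) / ((c : ℂ) * z + (d : ℂ))) =
          (raoC (toR !![(1 : ℤ), 0; -1, 1]) (toR R') : ℂ) *
            (raoC (toR (!![(1 : ℤ), 0; -1, 1] * R')) (toR !![(1 : ℤ), 0; 1, 1]) : ℂ) *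
            lamTheta S * sqrtBr ((c : ℂ) * z + (d : ℂ)) ^ 1 *
            χ ((d' : ℤ) : ZMod N) * thetaFHalfT χ t z) ∧
      (χ (-1 : ZMod N) = -1 →
        thetaFThreeHalfT χ t (((a : ℂ) * z + (b : ℂ)) / ((c : ℂ) * z + (d : ℂ))) =
          (raoC (toR !![(1 : ℤ), 0; -1, 1]) (toR R') : ℂ) *
            (raoC (toR (!![(1 : ℤ), 0; -1, 1] * R')) (toR !![(1 : ℤ), 0; 1, 1]) : ℂ) *
            lamTheta S * sqrtBr ((c : ℂ) * z + (d : ℂ)) ^ 3 *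
            χ ((d' : ℤ) : ZMod N) * thetaFThreeHalfT χ t z) := by
  intro R' S hR hS
  have htC : (t : ℂ) ≠ 0 := by exact_mod_cast (by omega : t ≠ 0)
  have ha1 : (a' : ℂ) = a := by exact_mod_cast congrArg (Rat.cast : ℚ → ℂ) ha
  have hb1 : (b' : ℂ) = t * b := by exact_mod_cast congrArg (Rat.cast : ℚ → ℂ) hb
  have hc1 : (c' : ℂ) = c / t := by exact_mod_cast congrArg (Rat.cast : ℚ → ℂ) hc
  have hd1 : (d' : ℂ) = d := by exact_mod_cast congrArg (Rat.cast : ℚ → ℂ) hd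
  have hw : 0 < ((t : ℂ) * z).im := by
    have : ((t : ℂ) * z).im = t * z.im := by simp
    rw [this]
    have : (0 : ℝ) < t := by exact_mod_cast ht
    positivity
  have hden : (c : ℂ) * z + d = c' * (t * z) + d' := by
    rw [hc1, hd1]; field_simp
  have hnum : (t : ℂ) * ((a * z + b) / (c * z + d)) = (a' * (t * z) + b') / (c' * (t * z) + d') := by
    rw [← hden, ha1, hb1, mul_div_assoc']; congr 1; ring
  have h2 := chi_two hNodd χ
  subst hR
  have hnu : (raoC (toR !![(1 : ℤ), 0; -1, 1]) (toR !![a', b'; c', d']) : ℂ) *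
            (raoC (toR (!![(1 : ℤ), 0; -1, 1] * !![a', b'; c', d'])) (toR !![(1 : ℤ), 0; 1, 1]) : ℂ) *
            lamTheta S = nu a' b' c' d' := by
    rw [hS]; rfl
  refine ⟨?_, fun hpar => ?_, fun hpar => ?_⟩
  · rw [hS, S_eq]
    exact S_even hdet' hc2
  · apply mul_left_cancel₀ h2
    rw [theta_half hNodd, hnum, Th_final hdet' hc2 N 0 (chi0 χ) hNodd hN2 (Or.inl rfl)
      (isChar_chi χ (by rw [hpar, pow_zero])) hw, ← theta_half hNodd, hnu, hden]
    simp only [chi0]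
    ring
  · apply mul_left_cancel₀ (mul_ne_zero two_ne_zero h2)
    rw [theta_three hNodd, hnum, Th_final hdet' hc2 N 1 (chi0 χ) hNodd hN2 (Or.inr rfl)
      (isChar_chi χ (by rw [hpar, pow_one])) hw, ← theta_three hNodd, hnu, hden]
    simp only [chi0]
    ring
end
end
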